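/- arXiv:2104.09012 — 2 statements merged into one kernel-verified Lean document; each statement's English description precedes it below -/
import Mathlib

section
/- Let Ω be a domain in ℝ^d. For any ε > 0 there exists τ_ε > 0 such that: if τ < τ_ε, B = B(x,R) is a ball centered at x ∈ ∂Ω with ∂Ω ∩ B ∈ Lip(τ), and h is a nonzero function continuous on the closure of Ω, harmonic in Ω, with h = 0 on ∂Ω ∩ B, then N_h(x₀, r) ≤ (1+ε) N_h(x₀, 2r) for every x₀ ∈ closure(Ω) ∩ B(x, R/4) and every 0 < r < R/16. -/
open Metric MeasureTheory Set
open scoped ENNReal NNReal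

noncomputable section

/-- `Euc m` is the Euclidean space `ℝ^(m+1)`. -/
abbrev Euc (m : ℕ) : Type := EuclideanSpace ℝ (Fin (m + 1))

/-- The first `m` coordinates of a point of `ℝ^(m+1)`. -/
def front {m : ℕ} (y : Euc m) : EuclideanSpace ℝ (Fin m) :=
  (WithLp.equiv 2 (∀ _ : Fin m, ℝ)).symm fun i : Fin m => y i.castSucc

/-- The last coordinate of a point of `ℝ^(m+1)`. -/
def lastC {m : ℕ} (y : Euc m) : ℝ := y (Fin.last m)

/-- The unit vector of `ℝ^(m+1)` in the last coordinate direction. -/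
def eLast (m : ℕ) : Euc m := EuclideanSpace.single (Fin.last m) 1

/-- The point `(x', 0) ∈ ℝ^(m+1)` determined by `x' ∈ ℝ^m`. -/
def pad {m : ℕ} (x' : EuclideanSpace ℝ (Fin m)) : Euc m :=
  (WithLp.equiv 2 (∀ _ : Fin (m + 1), ℝ)).symm
    (Fin.snoc (WithLp.equiv 2 (∀ _ : Fin m, ℝ) x') 0)

/-- The Laplacian of `h : ℝ^d → ℝ` at `x`: the sum of the pure second derivatives in the
coordinate directions. -/
def lap {d : ℕ} (h : EuclideanSpace ℝ (Fin d) → ℝ) (x : EuclideanSpace ℝ (Fin d)) : ℝ :=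
  ∑ i : Fin d, iteratedFDeriv ℝ 2 h x ![EuclideanSpace.single i 1, EuclideanSpace.single i 1]

/-- `h` is harmonic on `Ω`: it is twice continuously differentiable there and its
Laplacian vanishes. -/
def IsHarmonicOn {d : ℕ} (h : EuclideanSpace ℝ (Fin d) → ℝ)
    (Ω : Set (EuclideanSpace ℝ (Fin d))) : Prop :=
  ContDiffOn ℝ 2 h Ω ∧ ∀ x ∈ Ω, lap h x = 0

/-- `H_h(x,r) = ∫_{B(x,r) ∩ Ω} h²`. -/
def Hh {d : ℕ} (Ω : Set (EuclideanSpace ℝ (Fin d))) (h : EuclideanSpace ℝ (Fin d) → ℝ)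
    (x : EuclideanSpace ℝ (Fin d)) (r : ℝ) : ℝ :=
  ∫ y in ball x r ∩ Ω, (h y) ^ 2

/-- The doubling index `N_h(x,r) = log (H_h(x,2r) / H_h(x,r))`. -/
def Nh {d : ℕ} (Ω : Set (EuclideanSpace ℝ (Fin d))) (h : EuclideanSpace ℝ (Fin d) → ℝ)
    (x : EuclideanSpace ℝ (Fin d)) (r : ℝ) : ℝ :=
  Real.log (Hh Ω h x (2 * r) / Hh Ω h x r)

/-- `∂Ω ∩ B(x,r) ∈ Lip(τ)`: in suitable isometric coordinates centered at `x`, `Ω ∩ B(x,r)`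
is the region above the graph of a `τ`-Lipschitz function `f` with `f 0 = 0`. -/
def LipGraph {m : ℕ} (Ω : Set (Euc m)) (τ : ℝ≥0) (x : Euc m) (r : ℝ) : Prop :=
  ∃ T : Euc m ≃ᵢ Euc m, ∃ f : EuclideanSpace ℝ (Fin m) → ℝ,
    T 0 = x ∧ LipschitzOnWith τ f (ball 0 r) ∧ f 0 = 0 ∧
    Ω ∩ ball x r = T '' {y : Euc m | y ∈ ball (0 : Euc m) r ∧ f (front y) < lastC y}

/-- `∂Ω ∩ B(x,r)` is a `C^k`-smooth graph: same as `LipGraph` but with a `C^k` function. -/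
def SmoothGraph {m : ℕ} (k : ℕ) (Ω : Set (Euc m)) (x : Euc m) (r : ℝ) : Prop :=
  ∃ T : Euc m ≃ᵢ Euc m, ∃ f : EuclideanSpace ℝ (Fin m) → ℝ,
    T 0 = x ∧ ContDiffOn ℝ k f (ball 0 r) ∧ f 0 = 0 ∧
    Ω ∩ ball x r = T '' {y : Euc m | y ∈ ball (0 : Euc m) r ∧ f (front y) < lastC y}

/-- The closed axis-parallel cube with center `p` and side length `s`. -/
def cube {d : ℕ} (p : EuclideanSpace ℝ (Fin d)) (s : ℝ) : Set (EuclideanSpace ℝ (Fin d)) :=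
  {y | ∀ i, |y i - p i| ≤ s / 2}

/-- The maximal doubling index `N*_h(Q)` of `h` in the cube `Q`. -/
def Nstar {d : ℕ} (Ω : Set (EuclideanSpace ℝ (Fin d))) (h : EuclideanSpace ℝ (Fin d) → ℝ)
    (Q : Set (EuclideanSpace ℝ (Fin d))) : ℝ :=
  sSup {N : ℝ | ∃ x ∈ Q ∩ closure Ω, ∃ r : ℝ,
    Metric.diam Q / 2 ≤ r ∧ r ≤ Metric.diam Q ∧ N = Nh Ω h x r}

/-- Centers of the boundary cubes `q ∈ B_k(Q)` of the standard construction: `z` lies on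
`∂Ω ∩ Q` and its horizontal projection is the center of one of the `2^(k·m)` congruent
subcubes of side `s/2^k` partitioning the projection of `Q`. -/
def bCenters {m : ℕ} (Ω : Set (Euc m)) (xQ : Euc m) (s : ℝ) (k : ℕ) : Set (Euc m) :=
  {z | z ∈ frontier Ω ∩ cube xQ s ∧
    ∃ j : Fin m → Fin (2 ^ k), ∀ i : Fin m,
      front z i = front xQ i - s / 2 + (s / 2 ^ k) * ((j i : ℝ) + 1 / 2)}

open Filter Topology

/-! ### Truncations vanishing near zero -/

/-- A continuous approximation of the indicator function of `{s ≠ 0}`, vanishing for `|s| ≤ δ`. -/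
def cutoff (δ s : ℝ) : ℝ := max 0 (min 1 (|s| / δ - 1))

/-- The truncation of the identity whose derivative is `cutoff δ`. -/
def truncId (δ s : ℝ) : ℝ := ∫ y in (0 : ℝ)..s, cutoff δ y

/-- The truncation of `s ↦ s ^ 2 / 2` whose second derivative is `cutoff δ`. -/
def truncSq (δ s : ℝ) : ℝ := ∫ y in (0 : ℝ)..s, truncId δ y

lemma continuous_cutoff (δ : ℝ) : Continuous (cutoff δ) := by
  unfold cutoff; fun_prop

lemma cutoff_nonneg (δ s : ℝ) : 0 ≤ cutoff δ s := le_max_left _ _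

lemma cutoff_le_one (δ s : ℝ) : cutoff δ s ≤ 1 := max_le zero_le_one (min_le_left _ _)

lemma cutoff_eq_zero {δ s : ℝ} (hδ : 0 < δ) (h : |s| ≤ δ) : cutoff δ s = 0 := by
  have : |s| / δ ≤ 1 := (div_le_one hδ).2 h
  exact max_eq_left ((min_le_right _ _).trans (by linarith))

lemma cutoff_eq_one {δ s : ℝ} (hδ : 0 < δ) (h : 2 * δ ≤ |s|) : cutoff δ s = 1 := by
  have : 2 ≤ |s| / δ := (le_div_iff₀ hδ).2 h
  rw [cutoff, min_eq_left (by linarith), max_eq_right zero_le_one]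

lemma hasDerivAt_truncId (δ s : ℝ) : HasDerivAt (truncId δ) (cutoff δ s) s :=
  ((continuous_cutoff δ).integral_hasStrictDerivAt 0 s).hasDerivAt

lemma continuous_truncId (δ : ℝ) : Continuous (truncId δ) :=
  continuous_iff_continuousAt.2 fun s => (hasDerivAt_truncId δ s).continuousAt

lemma hasDerivAt_truncSq (δ s : ℝ) : HasDerivAt (truncSq δ) (truncId δ s) s :=
  ((continuous_truncId δ).integral_hasStrictDerivAt 0 s).hasDerivAt

lemma contDiff_truncId (δ : ℝ) : ContDiff ℝ 1 (truncId δ) := by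
  rw [contDiff_one_iff_deriv]
  refine ⟨fun s => (hasDerivAt_truncId δ s).differentiableAt, ?_⟩
  rw [funext fun s => (hasDerivAt_truncId δ s).deriv]
  exact continuous_cutoff δ

lemma contDiff_truncSq (δ : ℝ) : ContDiff ℝ 1 (truncSq δ) := by
  rw [contDiff_one_iff_deriv]
  refine ⟨fun s => (hasDerivAt_truncSq δ s).differentiableAt, ?_⟩
  rw [funext fun s => (hasDerivAt_truncSq δ s).deriv]
  exact continuous_truncId δ

lemma abs_le_of_mem_uIoc_zero {s y : ℝ} (hy : y ∈ Set.uIoc 0 s) : |y| ≤ |s| := by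
  rcases Set.mem_uIoc.1 hy with h | h
  · rw [abs_of_pos h.1]; exact h.2.trans (le_abs_self s)
  · rw [abs_of_nonpos h.2]; exact (neg_le_neg h.1.le).trans (neg_le_abs s)

lemma truncId_eq_zero {δ s : ℝ} (hδ : 0 < δ) (h : |s| ≤ δ) : truncId δ s = 0 :=
  intervalIntegral.integral_zero_ae <| Filter.Eventually.of_forall fun _ hy =>
    cutoff_eq_zero hδ ((abs_le_of_mem_uIoc_zero hy).trans h)

lemma truncSq_eq_zero {δ s : ℝ} (hδ : 0 < δ) (h : |s| ≤ δ) : truncSq δ s = 0 :=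
  intervalIntegral.integral_zero_ae <| Filter.Eventually.of_forall fun _ hy =>
    truncId_eq_zero hδ ((abs_le_of_mem_uIoc_zero hy).trans h)

lemma tendsto_cutoff {s : ℝ} (hs : s ≠ 0) : Tendsto (fun δ => cutoff δ s) (𝓝[>] 0) (𝓝 1) := by
  have h : ∀ᶠ δ in 𝓝[>] (0 : ℝ), δ < |s| / 2 :=
    nhdsWithin_le_nhds (Iio_mem_nhds (by positivity))
  refine tendsto_const_nhds.congr' ?_
  filter_upwards [h, self_mem_nhdsWithin] with δ h1 h2
  exact (cutoff_eq_one h2 (by linarith)).symm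

lemma abs_truncId_le (δ s : ℝ) : |truncId δ s| ≤ |s| := by
  have := intervalIntegral.norm_integral_le_of_norm_le_const (a := 0) (b := s) (C := 1)
    (f := cutoff δ) fun y _ => by
      rw [Real.norm_of_nonneg (cutoff_nonneg δ y)]; exact cutoff_le_one δ y
  simpa [truncId] using this

lemma abs_truncSq_le (δ s : ℝ) : |truncSq δ s| ≤ |s| ^ 2 := by
  have := intervalIntegral.norm_integral_le_of_norm_le_const (a := 0) (b := s) (C := |s|)
    (f := truncId δ) fun y hy => (abs_truncId_le δ y).trans (abs_le_of_mem_uIoc_zero hy)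
  simpa [truncSq, sq] using this

lemma tendsto_truncId (s : ℝ) : Tendsto (fun δ => truncId δ s) (𝓝[>] 0) (𝓝 s) := by
  have h := intervalIntegral.tendsto_integral_filter_of_dominated_convergence
    (μ := volume) (a := 0) (b := s) (F := cutoff) (f := fun _ => (1 : ℝ))
    (l := 𝓝[>] (0 : ℝ)) (fun _ => (1 : ℝ))
    (Eventually.of_forall fun δ => (continuous_cutoff δ).aestronglyMeasurable)
    (Eventually.of_forall fun δ => Eventually.of_forall fun y _ => by
      rw [Real.norm_of_nonneg (cutoff_nonneg δ y)]; exact cutoff_le_one δ y)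
    (by simp)
    (by
      have : ∀ᵐ y : ℝ, y ≠ 0 := by simp [ae_iff]
      filter_upwards [this] with y hy _
      exact tendsto_cutoff hy)
  simpa [truncId] using h

lemma tendsto_truncSq (s : ℝ) : Tendsto (fun δ => truncSq δ s) (𝓝[>] 0) (𝓝 (s ^ 2 / 2)) := by
  have h := intervalIntegral.tendsto_integral_filter_of_dominated_convergence
    (μ := volume) (a := 0) (b := s) (F := truncId) (f := fun y => y)
    (l := 𝓝[>] (0 : ℝ)) (fun _ => |s|)
    (Eventually.of_forall fun δ => (continuous_truncId δ).aestronglyMeasurable)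
    (Eventually.of_forall fun δ => Eventually.of_forall fun y hy =>
      (abs_truncId_le δ y).trans (abs_le_of_mem_uIoc_zero hy))
    (by simp)
    (Eventually.of_forall fun y _ => tendsto_truncId y)
  simpa [truncSq] using h

/-! ### The divergence theorem for compactly supported fields -/

lemma contDiff_of_contDiffOn_of_eq_zero {E : Type*} [NormedAddCommGroup E] [NormedSpace ℝ E]
    {f : E → ℝ} {K O : Set E} (hK : IsCompact K)
    (hO : IsOpen O) (hKO : K ⊆ O) (hf : ContDiffOn ℝ 1 f O) (h0 : ∀ x, x ∉ K → f x = 0) :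
    ContDiff ℝ 1 f := by
  rw [contDiff_iff_contDiffAt]
  intro x
  by_cases hx : x ∈ K
  · exact hf.contDiffAt (hO.mem_nhds (hKO hx))
  · refine (contDiffAt_const (c := (0 : ℝ))).congr_of_eventuallyEq ?_
    filter_upwards [hK.isClosed.isOpen_compl.mem_nhds hx] with y hy using h0 y hy

lemma fderiv_eq_zero_of_notMem {E : Type*} [NormedAddCommGroup E] [NormedSpace ℝ E]
    {f : E → ℝ} {K : Set E} (hK : IsCompact K)
    (h0 : ∀ x, x ∉ K → f x = 0) {x : E} (hx : x ∉ K) : fderiv ℝ f x = 0 := by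
  have : f =ᶠ[𝓝 x] fun _ => (0 : ℝ) := by
    filter_upwards [hK.isClosed.isOpen_compl.mem_nhds hx] with y hy using h0 y hy
  rw [this.fderiv_eq]; simp

section Divergence

variable {E : Type*} [NormedAddCommGroup E] [InnerProductSpace ℝ E] [FiniteDimensional ℝ E]
  [MeasurableSpace E] [BorelSpace E]

lemma integral_fderiv_apply_eq_zero {f : E → ℝ} (hf : ContDiff ℝ 1 f) (hc : HasCompactSupport f)
    (v : E) : ∫ x, fderiv ℝ f x v = 0 := by
  have hcont : Continuous fun x => fderiv ℝ f x v :=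
    (hf.continuous_fderiv one_ne_zero).clm_apply continuous_const
  have hint : Integrable fun x => fderiv ℝ f x v :=
    hcont.integrable_of_hasCompactSupport (hc.fderiv_apply ℝ v)
  have h := integral_mul_fderiv_eq_neg_fderiv_mul_of_integrable (𝕜 := ℝ) (μ := volume)
    (f := fun _ : E => (1 : ℝ)) (g := f) (v := v) (by simp) (by simpa using hint)
    (by simpa using hf.continuous.integrable_of_hasCompactSupport hc)
    (fun x _ => differentiableAt_const _) (fun x _ => hf.differentiable one_ne_zero x)
  simpa using h

lemma integral_sum_fderiv_eq_zero {ι : Type*} (s : Finset ι) {f : ι → E → ℝ} (v : ι → E)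
    {K O : Set E} (hK : IsCompact K) (hO : IsOpen O) (hKO : K ⊆ O)
    (hf : ∀ i, ContDiffOn ℝ 1 (f i) O) (h0 : ∀ i, ∀ x, x ∉ K → f i x = 0) :
    ∫ x, ∑ i ∈ s, fderiv ℝ (f i) x (v i) = 0 := by
  have hd : ∀ i, ContDiff ℝ 1 (f i) := fun i =>
    contDiff_of_contDiffOn_of_eq_zero hK hO hKO (hf i) (h0 i)
  have hc : ∀ i, HasCompactSupport (f i) := fun i => HasCompactSupport.intro hK (h0 i)
  rw [integral_finsetSum]
  · exact Finset.sum_eq_zero fun i _ => integral_fderiv_apply_eq_zero (hd i) (hc i) (v i)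
  · intro i _
    exact (((hd i).continuous_fderiv one_ne_zero).clm_apply
      continuous_const).integrable_of_hasCompactSupport ((hc i).fderiv_apply ℝ (v i))

end Divergence

lemma integrable_of_continuousOn_of_eq_zero {E : Type*} [NormedAddCommGroup E] [MeasurableSpace E]
    [BorelSpace E] {μ : Measure E} [IsFiniteMeasureOnCompacts μ]
    {f : E → ℝ} {K O : Set E} (hK : IsCompact K)
    (hKO : K ⊆ O) (hf : ContinuousOn f O) (h0 : ∀ x, x ∉ K → f x = 0) : Integrable f μ := by
  have h := (hf.mono hKO).integrableOn_compact (μ := μ) hK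
  rwa [integrableOn_iff_integrable_of_support_subset] at h
  intro x hx
  by_contra hxK
  exact hx (h0 x hxK)

/-! ### Radial weights -/

section Weights

variable {d : ℕ}

/-- The data `θ` of a radial weight: `θ` is nonincreasing and vanishes on `[1, ∞)`. -/
structure IsProfile (θ : ℝ → ℝ) : Prop where
  contDiff : ContDiff ℝ 2 θ
  eq_zero : ∀ σ, 1 ≤ σ → θ σ = 0
  deriv_nonpos : ∀ σ, deriv θ σ ≤ 0

/-- The radial function `θ (‖x‖ ^ 2)`. -/
def potential (θ : ℝ → ℝ) (x : EuclideanSpace ℝ (Fin d)) : ℝ := θ (‖x‖ ^ 2)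

/-- The weight `ψ` with `∇ (potential θ) x = - ψ x • x`. -/
def weight (θ : ℝ → ℝ) (x : EuclideanSpace ℝ (Fin d)) : ℝ := -2 * deriv θ (‖x‖ ^ 2)

/-- The divergence of the vector field `weight θ x • x`. -/
def divWeight (θ : ℝ → ℝ) (x : EuclideanSpace ℝ (Fin d)) : ℝ :=
  d * weight θ x + fderiv ℝ (weight θ) x x

/-- The pairing `⟨∇ v, ∇ w⟩`. -/
def gradDot (v w : EuclideanSpace ℝ (Fin d) → ℝ) (x : EuclideanSpace ℝ (Fin d)) : ℝ :=
  ∑ i, fderiv ℝ v x (EuclideanSpace.single i 1) * fderiv ℝ w x (EuclideanSpace.single i 1)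

lemma sum_apply_single (L : EuclideanSpace ℝ (Fin d) →L[ℝ] ℝ) (x : EuclideanSpace ℝ (Fin d)) :
    ∑ i, L (EuclideanSpace.single i 1) * x i = L x := by
  have h := (EuclideanSpace.basisFun (Fin d) ℝ).sum_repr x
  conv_rhs => rw [← h]
  simp [mul_comm]

lemma gradDot_self_nonneg (v : EuclideanSpace ℝ (Fin d) → ℝ) (x : EuclideanSpace ℝ (Fin d)) :
    0 ≤ gradDot v v x := Finset.sum_nonneg fun _ _ => mul_self_nonneg _

lemma gradDot_le (v w : EuclideanSpace ℝ (Fin d) → ℝ) (x : EuclideanSpace ℝ (Fin d)) :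
    gradDot v w x ≤ 1 / 2 * gradDot v v x + 1 / 2 * gradDot w w x := by
  unfold gradDot
  rw [Finset.mul_sum, Finset.mul_sum, ← Finset.sum_add_distrib]
  exact Finset.sum_le_sum fun i _ => by nlinarith [sq_nonneg (fderiv ℝ v x
    (EuclideanSpace.single i 1) - fderiv ℝ w x (EuclideanSpace.single i 1))]

lemma continuousOn_gradDot {v w : EuclideanSpace ℝ (Fin d) → ℝ}
    {O : Set (EuclideanSpace ℝ (Fin d))} (hO : IsOpen O) (hv : ContDiffOn ℝ 1 v O)
    (hw : ContDiffOn ℝ 1 w O) : ContinuousOn (gradDot v w) O := by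
  have hv' := hv.continuousOn_fderiv_of_isOpen hO le_rfl
  have hw' := hw.continuousOn_fderiv_of_isOpen hO le_rfl
  exact continuousOn_finsetSum _ fun i _ =>
    (hv'.clm_apply continuousOn_const).mul (hw'.clm_apply continuousOn_const)

namespace IsProfile

variable {θ : ℝ → ℝ}

lemma contDiff_deriv (hθ : IsProfile θ) : ContDiff ℝ 1 (deriv θ) :=
  ((contDiff_succ_iff_deriv (n := 1)).1 hθ.contDiff).2.2

lemma nonneg (hθ : IsProfile θ) (σ : ℝ) : 0 ≤ θ σ := by
  have h : Antitone θ := antitone_of_deriv_nonpos (hθ.contDiff.differentiable two_ne_zero)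
    hθ.deriv_nonpos
  calc 0 = θ (max σ 1) := (hθ.eq_zero _ (le_max_right _ _)).symm
    _ ≤ θ σ := h (le_max_left _ _)

lemma deriv_eq_zero (hθ : IsProfile θ) {σ : ℝ} (hσ : 1 < σ) : deriv θ σ = 0 := by
  have : θ =ᶠ[𝓝 σ] fun _ => 0 := by
    filter_upwards [Ioi_mem_nhds hσ] with y hy using hθ.eq_zero y hy.le
  rw [this.deriv_eq]; simp

lemma potential_nonneg (hθ : IsProfile θ) (x : EuclideanSpace ℝ (Fin d)) : 0 ≤ potential θ x :=
  hθ.nonneg _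

lemma weight_nonneg (hθ : IsProfile θ) (x : EuclideanSpace ℝ (Fin d)) : 0 ≤ weight θ x := by
  have := hθ.deriv_nonpos (‖x‖ ^ 2)
  unfold weight; linarith

lemma potential_eq_zero (hθ : IsProfile θ) {x : EuclideanSpace ℝ (Fin d)} (hx : 1 < ‖x‖) :
    potential θ x = 0 := hθ.eq_zero _ (by nlinarith)

lemma weight_eq_zero (hθ : IsProfile θ) {x : EuclideanSpace ℝ (Fin d)} (hx : 1 < ‖x‖) :
    weight θ x = 0 := by
  rw [weight, hθ.deriv_eq_zero (by nlinarith), mul_zero]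

lemma contDiff_potential (hθ : IsProfile θ) :
    ContDiff ℝ 2 (potential θ : EuclideanSpace ℝ (Fin d) → ℝ) :=
  hθ.contDiff.comp (contDiff_norm_sq ℝ)

lemma contDiff_weight (hθ : IsProfile θ) :
    ContDiff ℝ 1 (weight θ : EuclideanSpace ℝ (Fin d) → ℝ) :=
  contDiff_const.mul (hθ.contDiff_deriv.comp (contDiff_norm_sq ℝ))

lemma continuous_weight (hθ : IsProfile θ) :
    Continuous (weight θ : EuclideanSpace ℝ (Fin d) → ℝ) := hθ.contDiff_weight.continuous

lemma continuous_divWeight (hθ : IsProfile θ) :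
    Continuous (divWeight θ : EuclideanSpace ℝ (Fin d) → ℝ) :=
  (continuous_const.mul hθ.continuous_weight).add
    ((hθ.contDiff_weight.continuous_fderiv one_ne_zero).clm_apply continuous_id)

lemma fderiv_weight_eq_zero (hθ : IsProfile θ) {x : EuclideanSpace ℝ (Fin d)} (hx : 1 < ‖x‖) :
    fderiv ℝ (weight θ) x = 0 :=
  fderiv_eq_zero_of_notMem (isCompact_closedBall (0 : EuclideanSpace ℝ (Fin d)) 1)
    (fun y hy => hθ.weight_eq_zero (by simpa using hy)) (by simpa using hx)

lemma divWeight_eq_zero (hθ : IsProfile θ) {x : EuclideanSpace ℝ (Fin d)} (hx : 1 < ‖x‖) :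
    divWeight θ x = 0 := by
  simp [divWeight, hθ.weight_eq_zero hx, hθ.fderiv_weight_eq_zero hx]

lemma fderiv_potential_single (hθ : IsProfile θ) (x : EuclideanSpace ℝ (Fin d)) (i : Fin d) :
    fderiv ℝ (potential θ) x (EuclideanSpace.single i 1) = - (weight θ x * x i) := by
  have h1 : HasFDerivAt (fun y : EuclideanSpace ℝ (Fin d) => ‖y‖ ^ 2) (2 • innerSL ℝ x) x :=
    (hasStrictFDerivAt_norm_sq x).hasFDerivAt
  have h2 := ((hθ.contDiff.differentiable two_ne_zero (‖x‖ ^ 2)).hasDerivAt).comp_hasFDerivAt x h1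
  have h3 : fderiv ℝ (potential θ) x = _ := h2.fderiv
  rw [h3]
  simp [weight, EuclideanSpace.inner_single_right]
  ring

end IsProfile

end Weights

section Green

variable {d : ℕ} {θ : ℝ → ℝ} {u w : EuclideanSpace ℝ (Fin d) → ℝ}
  {O : Set (EuclideanSpace ℝ (Fin d))} {δ : ℝ}

/-- The part of the closed unit ball where `δ ≤ |w|`. -/
def superlevel (w : EuclideanSpace ℝ (Fin d) → ℝ) (δ : ℝ) : Set (EuclideanSpace ℝ (Fin d)) :=
  closedBall 0 1 ∩ {x | δ ≤ |w x|}

lemma isCompact_superlevel (hw : Continuous w) (δ : ℝ) : IsCompact (superlevel w δ) :=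
  (isCompact_closedBall _ _).inter_right (isClosed_le continuous_const hw.abs)

lemma superlevel_subset (hδ : 0 < δ) (hwO : ∀ x, ‖x‖ ≤ 1 → w x ≠ 0 → x ∈ O) :
    superlevel w δ ⊆ O := fun x hx => hwO x (by simpa using hx.1) fun h => by
  have := hx.2
  simp only [mem_ofPred_eq, h, abs_zero] at this
  linarith

lemma notMem_superlevel {x : EuclideanSpace ℝ (Fin d)} (hx : x ∉ superlevel w δ) :
    1 < ‖x‖ ∨ |w x| ≤ δ := by
  by_contra! h
  exact hx ⟨by simpa using h.1, h.2.le⟩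

/-- Green's identity for a harmonic function `u` tested against a truncation of `w`. -/
lemma integral_cutoff_gradDot (hθ : IsProfile θ) (hO : IsOpen O) (hu : ContDiffOn ℝ 2 u O)
    (hlap : ∀ x ∈ O, ∑ i, fderiv ℝ (fderiv ℝ u) x (EuclideanSpace.single i 1)
      (EuclideanSpace.single i 1) = 0)
    (hw : Continuous w) (hwd : ContDiffOn ℝ 2 w O) (hwO : ∀ x, ‖x‖ ≤ 1 → w x ≠ 0 → x ∈ O)
    (hδ : 0 < δ) :
    ∫ x, potential θ x * cutoff δ (w x) * gradDot w u x =
      ∫ x, weight θ x * truncId δ (w x) * fderiv ℝ u x x := by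
  have hK := isCompact_superlevel hw δ
  have hKO := superlevel_subset hδ hwO
  have hu1 : ContDiffOn ℝ 1 u O := hu.of_le (by norm_num)
  have hw1 : ContDiffOn ℝ 1 w O := hwd.of_le (by norm_num)
  have hgu : ContDiffOn ℝ 1 (fderiv ℝ u) O := hu.fderiv_of_isOpen hO (by norm_num)
  have hi1 : Integrable fun x => potential θ x * cutoff δ (w x) * gradDot w u x := by
    refine integrable_of_continuousOn_of_eq_zero hK hKO ?_ ?_
    · exact ((hθ.contDiff_potential.continuous.mul
        ((continuous_cutoff δ).comp hw)).continuousOn).mul (continuousOn_gradDot hO hw1 hu1)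
    · intro x hx
      rcases notMem_superlevel hx with h | h
      · simp [hθ.potential_eq_zero h]
      · simp [cutoff_eq_zero hδ h]
  have hi2 : Integrable fun x => weight θ x * truncId δ (w x) * fderiv ℝ u x x := by
    refine integrable_of_continuousOn_of_eq_zero hK hKO ?_ ?_
    · exact ((hθ.continuous_weight.mul
        ((continuous_truncId δ).comp hw)).continuousOn).mul
        (hgu.continuousOn.clm_apply continuousOn_id)
    · intro x hx
      rcases notMem_superlevel hx with h | h
      · simp [hθ.weight_eq_zero h]
      · simp [truncId_eq_zero hδ h]
  rw [← sub_eq_zero, ← integral_sub hi1 hi2]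
  set f : Fin d → EuclideanSpace ℝ (Fin d) → ℝ := fun i x =>
    truncId δ (w x) * potential θ x * fderiv ℝ u x (EuclideanSpace.single i 1) with hf
  have hf0 : ∀ i, ∀ x, x ∉ superlevel w δ → f i x = 0 := by
    intro i x hx
    rcases notMem_superlevel hx with h | h
    · simp [hf, hθ.potential_eq_zero h]
    · simp [hf, truncId_eq_zero hδ h]
  have key := integral_sum_fderiv_eq_zero (E := EuclideanSpace ℝ (Fin d)) Finset.univ
    (f := f) (fun i => EuclideanSpace.single i 1) hK hO hKO
    (fun i => (((contDiff_truncId δ).comp_contDiffOn hw1).mul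
      (hθ.contDiff_potential.of_le (by norm_num)).contDiffOn).mul
      (hgu.clm_apply contDiffOn_const)) hf0
  rw [← key]
  congr 1
  ext x
  by_cases hx : x ∈ superlevel w δ
  · have hxO := hKO hx
    have hn := hO.mem_nhds hxO
    have hdw : HasFDerivAt w (fderiv ℝ w x) x :=
      ((hw1.contDiffAt hn).differentiableAt one_ne_zero).hasFDerivAt
    have hdu : HasFDerivAt (fderiv ℝ u) (fderiv ℝ (fderiv ℝ u) x) x :=
      ((hgu.contDiffAt hn).differentiableAt one_ne_zero).hasFDerivAt
    have hdp : HasFDerivAt (potential θ) (fderiv ℝ (potential θ) x) x :=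
      (hθ.contDiff_potential.differentiable two_ne_zero x).hasFDerivAt
    have hfi : ∀ i, fderiv ℝ (f i) x (EuclideanSpace.single i 1) =
        truncId δ (w x) * potential θ x * fderiv ℝ (fderiv ℝ u) x (EuclideanSpace.single i 1)
          (EuclideanSpace.single i 1) + (potential θ x * cutoff δ (w x) *
          (fderiv ℝ w x (EuclideanSpace.single i 1) * fderiv ℝ u x (EuclideanSpace.single i 1)) -
          weight θ x * truncId δ (w x) * (fderiv ℝ u x (EuclideanSpace.single i 1) * x i)) := by
      intro i
      have h1 := ((hasDerivAt_truncId δ (w x)).comp_hasFDerivAt x hdw).mul hdp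
      have h2 := hdu.clm_apply (hasFDerivAt_const (EuclideanSpace.single i (1 : ℝ)) x)
      have h3 : fderiv ℝ (f i) x = _ := (h1.mul h2).fderiv
      rw [h3]
      simp [hθ.fderiv_potential_single]
      ring
    simp_rw [hfi]
    rw [Finset.sum_add_distrib, Finset.sum_sub_distrib, ← Finset.mul_sum, ← Finset.mul_sum,
      ← Finset.mul_sum, hlap x hxO, sum_apply_single, gradDot]
    ring
  · have h3 : ∀ i, fderiv ℝ (f i) x = 0 := fun i => fderiv_eq_zero_of_notMem hK (hf0 i) hx
    simp only [h3, zero_apply, Finset.sum_const_zero]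
    rcases notMem_superlevel hx with h | h
    · simp [hθ.potential_eq_zero h, hθ.weight_eq_zero h]
    · simp [cutoff_eq_zero hδ h, truncId_eq_zero hδ h]

lemma integral_weight_truncId (hθ : IsProfile θ) (hO : IsOpen O)
    (hw : Continuous w) (hwd : ContDiffOn ℝ 2 w O) (hwO : ∀ x, ‖x‖ ≤ 1 → w x ≠ 0 → x ∈ O)
    (hδ : 0 < δ) :
    ∫ x, weight θ x * truncId δ (w x) * fderiv ℝ w x x =
      - ∫ x, truncSq δ (w x) * divWeight θ x := by
  have hK := isCompact_superlevel hw δ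
  have hKO := superlevel_subset hδ hwO
  have hw1 : ContDiffOn ℝ 1 w O := hwd.of_le (by norm_num)
  have hgw : ContinuousOn (fderiv ℝ w) O := hw1.continuousOn_fderiv_of_isOpen hO le_rfl
  have hi2 : Integrable fun x => weight θ x * truncId δ (w x) * fderiv ℝ w x x := by
    refine integrable_of_continuousOn_of_eq_zero hK hKO ?_ ?_
    · exact ((hθ.continuous_weight.mul
        ((continuous_truncId δ).comp hw)).continuousOn).mul
        (hgw.clm_apply continuousOn_id)
    · intro x hx
      rcases notMem_superlevel hx with h | h
      · simp [hθ.weight_eq_zero h]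
      · simp [truncId_eq_zero hδ h]
  have hi1 : Integrable fun x => truncSq δ (w x) * divWeight θ x := by
    refine integrable_of_continuousOn_of_eq_zero hK hKO ?_ ?_
    · exact (((contDiff_truncSq δ).continuous.comp hw).mul
        hθ.continuous_divWeight).continuousOn
    · intro x hx
      rcases notMem_superlevel hx with h | h
      · simp [hθ.divWeight_eq_zero h]
      · simp [truncSq_eq_zero hδ h]
  rw [eq_neg_iff_add_eq_zero, ← integral_add hi2 hi1]
  set f : Fin d → EuclideanSpace ℝ (Fin d) → ℝ := fun i x =>
    truncSq δ (w x) * weight θ x * x i with hf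
  have hf0 : ∀ i, ∀ x, x ∉ superlevel w δ → f i x = 0 := by
    intro i x hx
    rcases notMem_superlevel hx with h | h
    · simp [hf, hθ.weight_eq_zero h]
    · simp [hf, truncSq_eq_zero hδ h]
  have key := integral_sum_fderiv_eq_zero (E := EuclideanSpace ℝ (Fin d)) Finset.univ
    (f := f) (fun i => EuclideanSpace.single i 1) hK hO hKO
    (fun i => (((contDiff_truncSq δ).comp_contDiffOn hw1).mul
      hθ.contDiff_weight.contDiffOn).mul
      (EuclideanSpace.proj i : EuclideanSpace ℝ (Fin d) →L[ℝ] ℝ).contDiff.contDiffOn) hf0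
  rw [← key]
  congr 1
  ext x
  by_cases hx : x ∈ superlevel w δ
  · have hxO := hKO hx
    have hn := hO.mem_nhds hxO
    have hdw : HasFDerivAt w (fderiv ℝ w x) x :=
      ((hw1.contDiffAt hn).differentiableAt one_ne_zero).hasFDerivAt
    have hdp : HasFDerivAt (weight θ) (fderiv ℝ (weight θ) x) x :=
      (hθ.contDiff_weight.differentiable one_ne_zero x).hasFDerivAt
    have hfi : ∀ i, fderiv ℝ (f i) x (EuclideanSpace.single i 1) =
        truncSq δ (w x) * weight θ x + (weight θ x * truncId δ (w x) *
          (fderiv ℝ w x (EuclideanSpace.single i 1) * x i) +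
          truncSq δ (w x) * (fderiv ℝ (weight θ) x (EuclideanSpace.single i 1) * x i)) := by
      intro i
      have h1 := ((hasDerivAt_truncSq δ (w x)).comp_hasFDerivAt x hdw).mul hdp
      have h2 := (EuclideanSpace.proj i : EuclideanSpace ℝ (Fin d) →L[ℝ] ℝ).hasFDerivAt (x := x)
      have h3 : fderiv ℝ (f i) x = _ := (h1.mul h2).fderiv
      rw [h3]
      simp
      ring
    simp_rw [hfi]
    rw [Finset.sum_add_distrib, Finset.sum_add_distrib, ← Finset.mul_sum,
      ← Finset.mul_sum, ← Finset.mul_sum, sum_apply_single, sum_apply_single]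
    simp [divWeight]
    ring
  · have h3 : ∀ i, fderiv ℝ (f i) x = 0 := fun i => fderiv_eq_zero_of_notMem hK (hf0 i) hx
    simp only [h3, zero_apply, Finset.sum_const_zero]
    rcases notMem_superlevel hx with h | h
    · simp [hθ.divWeight_eq_zero h, hθ.weight_eq_zero h]
    · simp [truncSq_eq_zero hδ h, truncId_eq_zero hδ h]

end Green

/-- The gradient of a function vanishes almost everywhere on its zero set. -/
lemma ae_fderiv_eq_zero_of_eq_zero {E : Type*} [NormedAddCommGroup E] [NormedSpace ℝ E]
    [FiniteDimensional ℝ E] [MeasurableSpace E] [BorelSpace E] (μ : Measure E)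
    [μ.IsAddHaarMeasure] {u : E → ℝ} {O : Set E} (hO : IsOpen O) (hc : Continuous u)
    (hu : ∀ x ∈ O, DifferentiableAt ℝ u x) :
    ∀ᵐ x ∂μ, x ∈ O → u x = 0 → fderiv ℝ u x = 0 := by
  rcases subsingleton_or_nontrivial E with hE | hE
  · exact Eventually.of_forall fun x _ _ => by
      ext v; rw [Subsingleton.elim v 0]; simp
  obtain ⟨e, he⟩ := exists_ne (0 : E)
  set A : Set E := O ∩ {x | u x = 0} with hA
  have hAm : MeasurableSet A :=
    hO.measurableSet.inter (isClosed_eq hc continuous_const).measurableSet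
  have happ : ApproximatesLinearOn (fun x => u x • e) (0 : E →L[ℝ] E) A 0 := by
    intro x hx y hy
    have h1 : u x = 0 := hx.2
    have h2 : u y = 0 := hy.2
    simp [h1, h2]
  have h := happ.norm_fderiv_sub_le μ hAm (fun x => (fderiv ℝ u x).smulRight e) fun x hx =>
    ((hu x hx.1).hasFDerivAt.smul_const e).hasFDerivWithinAt
  rw [ae_restrict_iff' hAm] at h
  filter_upwards [h] with x hx hxO hx0
  have h3 := hx ⟨hxO, hx0⟩
  simp only [sub_zero, nonpos_iff_eq_zero, nnnorm_eq_zero] at h3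
  ext v
  have h4 := congrArg (fun L : E →L[ℝ] E => L v) h3
  simpa [he] using h4

/-- Differentiation under the integral sign for integrands supported in a fixed compact set. -/
lemma hasDerivAt_integral_of_isCompact {E : Type*} [NormedAddCommGroup E] [MeasurableSpace E]
    [BorelSpace E] {μ : Measure E} [IsFiniteMeasureOnCompacts μ] {F F' : ℝ → E → ℝ} {a b t : ℝ}
    {K : Set E} (hK : IsCompact K) (ht : t ∈ Ioo a b)
    (hF : ∀ τ ∈ Ioo a b, ContinuousOn (F τ) K) (h0 : ∀ τ ∈ Ioo a b, ∀ x, x ∉ K → F τ x = 0)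
    (hd : ∀ τ ∈ Ioo a b, ∀ x ∈ K, HasDerivAt (fun τ => F τ x) (F' τ x) τ)
    (hc : ContinuousOn (Function.uncurry F') (Icc a b ×ˢ K)) :
    HasDerivAt (fun τ => ∫ x, F τ x ∂μ) (∫ x in K, F' t x ∂μ) t := by
  have hmem : Ioo a b ∈ 𝓝 t := Ioo_mem_nhds ht.1 ht.2
  obtain ⟨C, hC⟩ := (isCompact_Icc.prod hK).exists_bound_of_continuousOn hc
  have hF't : ContinuousOn (F' t) K :=
    hc.comp (f := fun x => (t, x)) (by fun_prop) fun x hx => ⟨Ioo_subset_Icc_self ht, hx⟩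
  have h := (hasDerivAt_integral_of_dominated_loc_of_deriv_le (μ := μ.restrict K) (F := F)
    (F' := F') (x₀ := t) (bound := fun _ => C) hmem
    (by
      filter_upwards [hmem] with τ hτ
      exact (hF τ hτ).aestronglyMeasurable_of_isCompact hK hK.measurableSet)
    ((hF t ht).integrableOn_compact hK)
    (hF't.aestronglyMeasurable_of_isCompact hK hK.measurableSet)
    ((ae_restrict_iff' hK.measurableSet).2 <| Eventually.of_forall fun x hx τ hτ =>
      hC (τ, x) ⟨Ioo_subset_Icc_self hτ, hx⟩)
    (integrableOn_const hK.measure_lt_top.ne)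
    ((ae_restrict_iff' hK.measurableSet).2 <| Eventually.of_forall fun x hx τ hτ =>
      hd τ hτ x hx)).2
  refine h.congr_of_eventuallyEq ?_
  filter_upwards [hmem] with τ hτ
  exact (setIntegral_eq_integral_of_forall_compl_eq_zero (h0 τ hτ)).symm

section Energy

variable {d : ℕ} {θ : ℝ → ℝ}

lemma IsProfile.integrable_weight_mul (hθ : IsProfile θ) {g : EuclideanSpace ℝ (Fin d) → ℝ}
    (hg : Continuous g) : Integrable fun x => weight θ x * g x :=
  integrable_of_continuousOn_of_eq_zero (O := univ)
    (isCompact_closedBall (0 : EuclideanSpace ℝ (Fin d)) 1)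
    (subset_univ _) (hθ.continuous_weight.mul hg).continuousOn fun x hx => by
      rw [hθ.weight_eq_zero (by simpa using hx), zero_mul]

lemma IsProfile.integrable_divWeight_mul (hθ : IsProfile θ) {g : EuclideanSpace ℝ (Fin d) → ℝ}
    (hg : Continuous g) : Integrable fun x => divWeight θ x * g x :=
  integrable_of_continuousOn_of_eq_zero (O := univ)
    (isCompact_closedBall (0 : EuclideanSpace ℝ (Fin d)) 1)
    (subset_univ _) (hθ.continuous_divWeight.mul hg).continuousOn fun x hx => by
      rw [hθ.divWeight_eq_zero (by simpa using hx), zero_mul]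

/-- The Caccioppoli-type bound on the energy of a harmonic function with zero boundary values. -/
lemma setIntegral_gradDot_le {u : EuclideanSpace ℝ (Fin d) → ℝ}
    {O A : Set (EuclideanSpace ℝ (Fin d))} (hθ : IsProfile θ) (hO : IsOpen O)
    (hu : ContDiffOn ℝ 2 u O)
    (hlap : ∀ x ∈ O, ∑ i, fderiv ℝ (fderiv ℝ u) x (EuclideanSpace.single i 1)
      (EuclideanSpace.single i 1) = 0)
    (hc : Continuous u) (huO : ∀ x, ‖x‖ ≤ 1 → u x ≠ 0 → x ∈ O)
    (hA : IsCompact A) (hAO : A ⊆ O) :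
    ∫ x in A, potential θ x * gradDot u u x ≤ -(1 / 2) * ∫ x, divWeight θ x * u x ^ 2 := by
  have hu1 : ContDiffOn ℝ 1 u O := hu.of_le (by norm_num)
  have hgc : ContinuousOn (gradDot u u) O := continuousOn_gradDot hO hu1 hu1
  have hpc : Continuous (potential θ : EuclideanSpace ℝ (Fin d) → ℝ) :=
    hθ.contDiff_potential.continuous
  have hle : ∀ δ : ℝ, 0 < δ → ∫ x in A, potential θ x * cutoff δ (u x) * gradDot u u x ≤
      - ∫ x, truncSq δ (u x) * divWeight θ x := by
    intro δ hδ
    rw [← integral_weight_truncId hθ hO hc hu huO hδ,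
      ← integral_cutoff_gradDot hθ hO hu hlap hc hu huO hδ]
    refine setIntegral_le_integral ?_ (Eventually.of_forall fun x => ?_)
    · refine integrable_of_continuousOn_of_eq_zero (isCompact_superlevel hc δ)
        (superlevel_subset hδ huO) ?_ ?_
      · exact (hpc.mul ((continuous_cutoff δ).comp hc)).continuousOn.mul hgc
      · intro x hx
        rcases notMem_superlevel hx with h | h
        · simp [hθ.potential_eq_zero h]
        · simp [cutoff_eq_zero hδ h]
    · exact mul_nonneg (mul_nonneg (hθ.potential_nonneg x) (cutoff_nonneg _ _))
        (gradDot_self_nonneg u x)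
  have hl : Tendsto (fun δ => ∫ x in A, potential θ x * cutoff δ (u x) * gradDot u u x)
      (𝓝[>] 0) (𝓝 (∫ x in A, potential θ x * gradDot u u x)) := by
    refine tendsto_integral_filter_of_dominated_convergence
      (fun x => potential θ x * gradDot u u x) (Eventually.of_forall fun δ => ?_)
      (Eventually.of_forall fun δ => Eventually.of_forall fun x => ?_) ?_ ?_
    · exact (((hpc.mul ((continuous_cutoff δ).comp hc)).continuousOn.mul
        hgc).mono hAO).aestronglyMeasurable_of_isCompact hA hA.measurableSet
    · rw [Real.norm_of_nonneg (mul_nonneg (mul_nonneg (hθ.potential_nonneg x)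
        (cutoff_nonneg _ _)) (gradDot_self_nonneg u x))]
      refine mul_le_mul_of_nonneg_right ?_ (gradDot_self_nonneg u x)
      exact mul_le_of_le_one_right (hθ.potential_nonneg x) (cutoff_le_one _ _)
    · exact ((hpc.continuousOn.mul hgc).mono hAO).integrableOn_compact hA
    · rw [ae_restrict_iff' hA.measurableSet]
      filter_upwards [ae_fderiv_eq_zero_of_eq_zero volume hO hc fun x hx =>
        (hu1.contDiffAt (hO.mem_nhds hx)).differentiableAt one_ne_zero] with x hx hxA
      by_cases h0 : u x = 0
      · have : gradDot u u x = 0 := by simp [gradDot, hx (hAO hxA) h0]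
        simp [this]
      · simpa using ((tendsto_cutoff h0).const_mul (potential θ x)).mul_const (gradDot u u x)
  have hr : Tendsto (fun δ => - ∫ x, truncSq δ (u x) * divWeight θ x)
      (𝓝[>] 0) (𝓝 (- ∫ x, u x ^ 2 / 2 * divWeight θ x)) := by
    refine (tendsto_integral_filter_of_dominated_convergence
      (fun x => |divWeight θ x * u x ^ 2|) (Eventually.of_forall fun δ => ?_)
      (Eventually.of_forall fun δ => Eventually.of_forall fun x => ?_) ?_ ?_).neg
    · exact (((contDiff_truncSq δ).continuous.comp hc).mul
        hθ.continuous_divWeight).aestronglyMeasurable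
    · rw [norm_mul, mul_comm, abs_mul, abs_pow]
      exact mul_le_mul_of_nonneg_left (abs_truncSq_le _ _) (abs_nonneg _)
    · exact (hθ.integrable_divWeight_mul (hc.pow 2)).abs
    · exact Eventually.of_forall fun x => (tendsto_truncSq (u x)).mul_const _
  have := le_of_tendsto_of_tendsto hl hr (eventually_nhdsWithin_of_forall fun δ hδ => hle δ hδ)
  refine this.trans_eq ?_
  rw [← integral_neg, ← integral_const_mul]
  congr 1
  ext x
  ring

end Energy

section Scaling

variable {d : ℕ} {θ : ℝ → ℝ} {U : EuclideanSpace ℝ (Fin d) → ℝ}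

/-- The weighted `L²`-mass of `U` at the logarithmic scale `t`. -/
def mass (θ : ℝ → ℝ) (U : EuclideanSpace ℝ (Fin d) → ℝ) (t : ℝ) : ℝ :=
  ∫ x, weight θ x * U (Real.exp t • x) ^ 2

/-- The weighted energy of `U` at the logarithmic scale `t`. -/
def energy (θ : ℝ → ℝ) (U : EuclideanSpace ℝ (Fin d) → ℝ) (t : ℝ) : ℝ :=
  -(1 / 2) * ∫ x, divWeight θ x * U (Real.exp t • x) ^ 2

lemma integral_comp_exp_smul (g : EuclideanSpace ℝ (Fin d) → ℝ) (t : ℝ) :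
    ∫ x, g (Real.exp t • x) = Real.exp (-(d * t)) * ∫ x, g x := by
  rw [Measure.integral_comp_smul, finrank_euclideanSpace, Fintype.card_fin, smul_eq_mul,
    abs_of_pos (by positivity), Real.exp_neg, Real.exp_nat_mul]

lemma mass_eq (θ : ℝ → ℝ) (U : EuclideanSpace ℝ (Fin d) → ℝ) (t : ℝ) :
    mass θ U t = Real.exp (-(d * t)) * ∫ y, weight θ (Real.exp (-t) • y) * U y ^ 2 := by
  rw [← integral_comp_exp_smul, mass]
  simp [smul_smul, ← Real.exp_add]

lemma hasDerivAt_mass (hθ : IsProfile θ) (hU : Continuous U) (t : ℝ) :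
    HasDerivAt (mass θ U) (2 * energy θ U t) t := by
  have hfw : Continuous (fderiv ℝ (weight θ : EuclideanSpace ℝ (Fin d) → ℝ)) :=
    hθ.contDiff_weight.continuous_fderiv one_ne_zero
  set F' : ℝ → EuclideanSpace ℝ (Fin d) → ℝ := fun τ y =>
    fderiv ℝ (weight θ) (Real.exp (-τ) • y) (-(Real.exp (-τ) • y)) * U y ^ 2 with hF'
  have hout : ∀ τ ∈ Ioo (t - 1) (t + 1), ∀ y : EuclideanSpace ℝ (Fin d),
      y ∉ closedBall 0 (Real.exp (t + 1)) → 1 < ‖Real.exp (-τ) • y‖ := by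
    intro τ hτ y hy
    rw [norm_smul, Real.norm_of_nonneg (Real.exp_pos _).le]
    have h1 : Real.exp (t + 1) < ‖y‖ := by simpa using hy
    calc (1 : ℝ) = Real.exp (-τ) * Real.exp τ := by rw [← Real.exp_add]; simp
      _ < Real.exp (-τ) * ‖y‖ := by
        refine mul_lt_mul_of_pos_left (lt_trans ?_ h1) (Real.exp_pos _)
        exact Real.exp_lt_exp.2 hτ.2
  have hmem : t ∈ Ioo (t - 1) (t + 1) := ⟨by linarith, by linarith⟩
  have h1 : HasDerivAt (fun τ => ∫ y, weight θ (Real.exp (-τ) • y) * U y ^ 2)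
      (∫ y in closedBall 0 (Real.exp (t + 1)), F' t y) t := by
    refine hasDerivAt_integral_of_isCompact (a := t - 1) (b := t + 1) (isCompact_closedBall _ _)
      hmem ?_ ?_ ?_ ?_
    · intro τ _
      exact ((hθ.continuous_weight.comp (continuous_const_smul _)).mul (hU.pow 2)).continuousOn
    · intro τ hτ y hy
      rw [hθ.weight_eq_zero (hout τ hτ y hy), zero_mul]
    · intro τ _ y _
      have h2 : HasDerivAt (fun τ : ℝ => Real.exp (-τ) • y) (-(Real.exp (-τ) • y)) τ := by
        simpa using ((hasDerivAt_neg τ).exp).smul_const y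
      exact ((hθ.contDiff_weight.differentiable one_ne_zero
        _).hasFDerivAt.comp_hasDerivAt τ h2).mul_const _
    · refine Continuous.continuousOn ?_
      have h3 : Continuous fun p : ℝ × EuclideanSpace ℝ (Fin d) => Real.exp (-p.1) • p.2 := by
        fun_prop
      exact ((hfw.comp h3).clm_apply h3.neg).mul ((hU.comp continuous_snd).pow 2)
  rw [setIntegral_eq_integral_of_forall_compl_eq_zero (fun y hy => by
    simp [hF', hθ.fderiv_weight_eq_zero (hout t hmem y hy)])] at h1
  have h4 : HasDerivAt (fun τ : ℝ => Real.exp (-(d * τ))) (-d * Real.exp (-(d * t))) t := by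
    have := (((hasDerivAt_id t).const_mul (d : ℝ)).neg).exp
    simpa [mul_comm] using this
  have h5 := h4.mul h1
  rw [funext (mass_eq θ U)]
  refine h5.congr_deriv ?_
  rw [mul_assoc, ← mass_eq, mass, ← integral_comp_exp_smul, energy, ← integral_const_mul,
    ← integral_const_mul, ← integral_const_mul, ← integral_add]
  · congr 1
    ext x
    have h6 : Real.exp (-t) • Real.exp t • x = x := by simp [smul_smul, ← Real.exp_add]
    simp only [hF', h6, divWeight, map_neg]
    ring
  · exact (hθ.integrable_weight_mul ((hU.comp (continuous_const_smul _)).pow 2)).const_mul _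
  · refine integrable_of_continuousOn_of_eq_zero (O := univ)
      (isCompact_closedBall (0 : EuclideanSpace ℝ (Fin d)) 1) (subset_univ _) ?_ ?_
    · have h3 : Continuous fun p : EuclideanSpace ℝ (Fin d) => Real.exp (-t) • p := by fun_prop
      exact (((hfw.comp h3).clm_apply h3.neg).mul (hU.pow 2)).comp
        (continuous_const_smul (Real.exp t)) |>.continuousOn
    · intro x hx
      have : 1 < ‖x‖ := by simpa using hx
      simp [hF', smul_smul, ← Real.exp_add, hθ.fderiv_weight_eq_zero this]

end Scaling

section Star

variable {d : ℕ} {θ : ℝ → ℝ} {U : EuclideanSpace ℝ (Fin d) → ℝ}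
  {D : Set (EuclideanSpace ℝ (Fin d))} {R : ℝ}

/-- `U` is harmonic in `D`, which is star-shaped about the origin, and `U` vanishes on the part
of the ball of radius `R` outside `D`. -/
structure IsStarHarmonic (U : EuclideanSpace ℝ (Fin d) → ℝ) (D : Set (EuclideanSpace ℝ (Fin d)))
    (R : ℝ) : Prop where
  continuous : Continuous U
  isOpen : IsOpen D
  smul_mem : ∀ x ∈ D, ∀ c : ℝ, 0 < c → c ≤ 1 → c • x ∈ D
  mem_of_ne_zero : ∀ x, ‖x‖ < R → U x ≠ 0 → x ∈ D
  contDiffOn : ContDiffOn ℝ 2 U D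
  laplacian_eq_zero : ∀ x ∈ D, ∑ i, fderiv ℝ (fderiv ℝ U) x (EuclideanSpace.single i 1)
    (EuclideanSpace.single i 1) = 0

/-- A version of `fderiv ℝ (fderiv ℝ U)` under scaling of the argument. -/
lemma fderiv_fderiv_comp_smul (U : EuclideanSpace ℝ (Fin d) → ℝ) (c : ℝ)
    (x v w : EuclideanSpace ℝ (Fin d)) :
    fderiv ℝ (fderiv ℝ fun y => U (c • y)) x v w = c ^ 2 * fderiv ℝ (fderiv ℝ U) (c • x) v w := by
  have h : (fderiv ℝ fun y => U (c • y)) = fun y => c • fderiv ℝ U (c • y) :=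
    funext fun y => fderiv_comp_smul c
  have h2 : fderiv ℝ (fun y => c • fderiv ℝ U (c • y)) x =
      c • fderiv ℝ (fun y => fderiv ℝ U (c • y)) x  :=
    congrFun (fderiv_const_smul_field (f := fun y => fderiv ℝ U (c • y)) c) x
  rw [h, h2, fderiv_comp_smul]
  simp [sq, mul_assoc]

namespace IsStarHarmonic

lemma norm_exp_smul_lt {t : ℝ} (ht : Real.exp t < R) {x : EuclideanSpace ℝ (Fin d)}
    (hx : ‖x‖ ≤ 1) : ‖Real.exp t • x‖ < R := by
  rw [norm_smul, Real.norm_of_nonneg (Real.exp_pos _).le]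
  exact (mul_le_of_le_one_right (Real.exp_pos _).le hx).trans_lt ht

lemma exp_smul_mem (h : IsStarHarmonic U D R) {τ s : ℝ} (hτ : τ ≤ s)
    {x : EuclideanSpace ℝ (Fin d)} (hx : Real.exp s • x ∈ D) : Real.exp τ • x ∈ D := by
  have := h.smul_mem _ hx (Real.exp (τ - s)) (Real.exp_pos _)
    (Real.exp_le_one_iff.2 (by linarith))
  rwa [smul_smul, ← Real.exp_add, sub_add_cancel] at this

lemma setIntegral_gradDot_le_energy (h : IsStarHarmonic U D R) (hθ : IsProfile θ) {t : ℝ}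
    (ht : Real.exp t < R) {A : Set (EuclideanSpace ℝ (Fin d))} (hA : IsCompact A)
    (hAD : ∀ x ∈ A, Real.exp t • x ∈ D) :
    ∫ x in A, potential θ x * gradDot (fun y => U (Real.exp t • y))
      (fun y => U (Real.exp t • y)) x ≤ energy θ U t := by
  have hs : Continuous fun y : EuclideanSpace ℝ (Fin d) => Real.exp t • y :=
    continuous_const_smul _
  refine setIntegral_gradDot_le (O := (fun y => Real.exp t • y) ⁻¹' D) hθ
    (h.isOpen.preimage hs) ?_ ?_ (h.continuous.comp hs) ?_ hA hAD
  · exact h.contDiffOn.comp (contDiff_const_smul _).contDiffOn fun x hx => hx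
  · intro x hx
    simp_rw [fderiv_fderiv_comp_smul]
    rw [← Finset.mul_sum, h.laplacian_eq_zero _ hx, mul_zero]
  · intro x hx h0
    exact h.mem_of_ne_zero _ (norm_exp_smul_lt ht hx) h0

/-- Comparison of the derivative of the truncated two-scale pairing with the energies. -/
lemma exists_hasDerivAt_pairing (h : IsStarHarmonic U D R) (hθ : IsProfile θ) {τ s δ : ℝ}
    (hs : Real.exp s < R) (hτ : τ < s) (hδ : 0 < δ) :
    ∃ e' : ℝ, e' ≤ 1 / 2 * energy θ U s + 1 / 2 * energy θ U τ ∧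
      HasDerivAt (fun τ => ∫ x, weight θ x * truncId δ (U (Real.exp s • x)) *
        U (Real.exp τ • x)) e' τ := by
  have hcs : ∀ t : ℝ, Continuous fun y : EuclideanSpace ℝ (Fin d) => Real.exp t • y :=
    fun t => continuous_const_smul _
  have hτR : Real.exp τ < R := (Real.exp_lt_exp.2 hτ).trans hs
  set w : EuclideanSpace ℝ (Fin d) → ℝ := fun y => U (Real.exp s • y) with hw
  set u : EuclideanSpace ℝ (Fin d) → ℝ := fun y => U (Real.exp τ • y) with hu
  set O : Set (EuclideanSpace ℝ (Fin d)) := (fun y => Real.exp s • y) ⁻¹' D with hOdef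
  have hO : IsOpen O := h.isOpen.preimage (hcs s)
  have hwc : Continuous w := h.continuous.comp (hcs s)
  have hwO : ∀ x, ‖x‖ ≤ 1 → w x ≠ 0 → x ∈ O := fun x hx h0 =>
    h.mem_of_ne_zero _ (norm_exp_smul_lt hs hx) h0
  have hwd : ContDiffOn ℝ 2 w O :=
    h.contDiffOn.comp (contDiff_const_smul _).contDiffOn fun x hx => hx
  have hud : ContDiffOn ℝ 2 u O :=
    h.contDiffOn.comp (contDiff_const_smul _).contDiffOn fun x hx => h.exp_smul_mem hτ.le hx
  have hw1 : ContDiffOn ℝ 1 w O := hwd.of_le (by norm_num)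
  have hu1 : ContDiffOn ℝ 1 u O := hud.of_le (by norm_num)
  have hlap : ∀ x ∈ O, ∑ i, fderiv ℝ (fderiv ℝ u) x (EuclideanSpace.single i 1)
      (EuclideanSpace.single i 1) = 0 := by
    intro x hx
    simp_rw [hu, fderiv_fderiv_comp_smul]
    rw [← Finset.mul_sum, h.laplacian_eq_zero _ (h.exp_smul_mem hτ.le hx), mul_zero]
  set K := superlevel w δ with hKdef
  have hK : IsCompact K := isCompact_superlevel hwc δ
  have hKO : K ⊆ O := superlevel_subset hδ hwO
  have hpc : Continuous (potential θ : EuclideanSpace ℝ (Fin d) → ℝ) :=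
    hθ.contDiff_potential.continuous
  have hDU : ContinuousOn (fderiv ℝ U) D :=
    (h.contDiffOn.of_le (m := 1) (by norm_num)).continuousOn_fderiv_of_isOpen h.isOpen le_rfl
  have hK0 : ∀ x, x ∉ K → weight θ x * truncId δ (w x) = 0 := by
    intro x hx
    rcases notMem_superlevel hx with h1 | h1
    · rw [hθ.weight_eq_zero h1, zero_mul]
    · rw [truncId_eq_zero hδ h1, mul_zero]
  have hder := hasDerivAt_integral_of_isCompact (μ := volume) (a := τ - 1) (b := s) (t := τ)
    (F := fun τ x => weight θ x * truncId δ (w x) * U (Real.exp τ • x))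
    (F' := fun τ x => weight θ x * truncId δ (w x) *
      fderiv ℝ U (Real.exp τ • x) (Real.exp τ • x)) hK ⟨by linarith, hτ⟩
    (fun σ _ => ((hθ.continuous_weight.mul ((continuous_truncId δ).comp hwc)).mul
      (h.continuous.comp (hcs σ))).continuousOn)
    (fun σ _ x hx => by rw [hK0 x hx, zero_mul])
    (fun σ hσ x hx => by
      have hxD : Real.exp σ • x ∈ D := h.exp_smul_mem hσ.2.le (hKO hx)
      have h1 : HasDerivAt (fun σ : ℝ => Real.exp σ • x) (Real.exp σ • x) σ :=
        (Real.hasDerivAt_exp σ).smul_const x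
      exact ((((h.contDiffOn.contDiffAt (h.isOpen.mem_nhds hxD)).differentiableAt
        two_ne_zero).hasFDerivAt.comp_hasDerivAt σ h1).const_mul _))
    (by
      have h3 : Continuous fun p : ℝ × EuclideanSpace ℝ (Fin d) => Real.exp p.1 • p.2 := by
        fun_prop
      have h4 : Continuous fun p : ℝ × EuclideanSpace ℝ (Fin d) =>
          weight θ p.2 * truncId δ (w p.2) :=
        (hθ.continuous_weight.mul ((continuous_truncId δ).comp hwc)).comp continuous_snd
      exact h4.continuousOn.mul ((hDU.comp h3.continuousOn fun p hp =>
        h.exp_smul_mem hp.1.2 (hKO hp.2)).clm_apply h3.continuousOn))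
  refine ⟨_, ?_, hder⟩
  have hfu : ∀ x, fderiv ℝ U (Real.exp τ • x) (Real.exp τ • x) = fderiv ℝ u x x := by
    intro x
    have : fderiv ℝ u x = Real.exp τ • fderiv ℝ U (Real.exp τ • x) := fderiv_comp_smul _
    rw [this]; simp
  have h5 := integral_cutoff_gradDot hθ hO hud hlap hwc hwd hwO hδ
  rw [setIntegral_eq_integral_of_forall_compl_eq_zero (fun x hx => by
    simp only [hK0 x hx, zero_mul])]
  simp_rw [hfu]
  rw [← h5, ← setIntegral_eq_integral_of_forall_compl_eq_zero (s := K) (fun x hx => by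
    rcases notMem_superlevel hx with h1 | h1
    · simp [hθ.potential_eq_zero h1]
    · simp [cutoff_eq_zero hδ h1])]
  have hE1 := h.setIntegral_gradDot_le_energy hθ hs hK hKO
  have hE2 := h.setIntegral_gradDot_le_energy hθ hτR hK
    fun x hx => h.exp_smul_mem hτ.le (hKO hx)
  have hi : ∀ v, ContDiffOn ℝ 1 v O →
      IntegrableOn (fun x => potential θ x * gradDot v v x) K := fun v hv =>
    ((hpc.continuousOn.mul (continuousOn_gradDot hO hv hv)).mono hKO).integrableOn_compact hK
  calc ∫ x in K, potential θ x * cutoff δ (w x) * gradDot w u x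
      ≤ ∫ x in K, (1 / 2 * (potential θ x * gradDot w w x) +
          1 / 2 * (potential θ x * gradDot u u x)) := by
        refine setIntegral_mono_on ?_ (((hi w hw1).const_mul _).add ((hi u hu1).const_mul _))
          hK.measurableSet fun x _ => ?_
        · exact (((hpc.mul ((continuous_cutoff δ).comp hwc)).continuousOn.mul
            (continuousOn_gradDot hO hw1 hu1)).mono hKO).integrableOn_compact hK
        · have hp := hθ.potential_nonneg x
          have hS : 0 ≤ 1 / 2 * gradDot w w x + 1 / 2 * gradDot u u x := by
            have := gradDot_self_nonneg w x
            have := gradDot_self_nonneg u x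
            positivity
          calc potential θ x * cutoff δ (w x) * gradDot w u x
              ≤ potential θ x * cutoff δ (w x) *
                (1 / 2 * gradDot w w x + 1 / 2 * gradDot u u x) :=
                mul_le_mul_of_nonneg_left (gradDot_le w u x) (mul_nonneg hp (cutoff_nonneg _ _))
            _ ≤ potential θ x * (1 / 2 * gradDot w w x + 1 / 2 * gradDot u u x) :=
                mul_le_mul_of_nonneg_right
                  (mul_le_of_le_one_right hp (cutoff_le_one _ _)) hS
            _ = _ := by ring
    _ = 1 / 2 * (∫ x in K, potential θ x * gradDot w w x) +
          1 / 2 * ∫ x in K, potential θ x * gradDot u u x := by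
        rw [integral_add ((hi w hw1).const_mul _) ((hi u hu1).const_mul _),
          integral_const_mul, integral_const_mul]
    _ ≤ _ := by
        simp only [hw, hu]
        linarith [hE1, hE2]

lemma continuous_pairing (hθ : IsProfile θ) {g : EuclideanSpace ℝ (Fin d) → ℝ}
    (hg : Continuous g) (hU : Continuous U) :
    Continuous fun τ => ∫ x, weight θ x * g x * U (Real.exp τ • x) := by
  have h1 : ∀ τ : ℝ, ∫ x, weight θ x * g x * U (Real.exp τ • x) =
      ∫ x in closedBall 0 1, weight θ x * g x * U (Real.exp τ • x) := fun τ =>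
    (setIntegral_eq_integral_of_forall_compl_eq_zero fun x hx => by
      rw [hθ.weight_eq_zero (by simpa using hx), zero_mul, zero_mul]).symm
  rw [funext h1]
  refine continuous_parametric_integral_of_continuous ?_ (isCompact_closedBall _ _)
  have h3 : Continuous fun p : ℝ × EuclideanSpace ℝ (Fin d) => Real.exp p.1 • p.2 := by fun_prop
  exact (((hθ.continuous_weight.mul hg).comp continuous_snd).mul (hU.comp h3))

lemma two_scale_truncId (h : IsStarHarmonic U D R) (hθ : IsProfile θ) {t s δ : ℝ}
    (hs : Real.exp s < R) (hts : t < s) (hδ : 0 < δ) :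
    (∫ x, weight θ x * truncId δ (U (Real.exp s • x)) * U (Real.exp s • x)) -
      (∫ x, weight θ x * truncId δ (U (Real.exp s • x)) * U (Real.exp t • x)) ≤
      1 / 2 * (s - t) * energy θ U s + 1 / 4 * (mass θ U s - mass θ U t) := by
  set P : ℝ → ℝ := fun τ => ∫ x, weight θ x * truncId δ (U (Real.exp s • x)) *
    U (Real.exp τ • x) with hP
  have hPc : Continuous P := continuous_pairing hθ ((continuous_truncId δ).comp
    (h.continuous.comp (continuous_const_smul (Real.exp s)))) h.continuous
  set G : ℝ → ℝ := fun τ => P τ - 1 / 2 * energy θ U s * τ - 1 / 4 * mass θ U τ with hG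
  have hm : ∀ τ, HasDerivAt (mass θ U) (2 * energy θ U τ) τ := hasDerivAt_mass hθ h.continuous
  have hGc : Continuous G := by
    have : Continuous (mass θ U) := continuous_iff_continuousAt.2 fun τ => (hm τ).continuousAt
    fun_prop
  have hGd : ∀ τ < s, ∃ g ≤ 0, HasDerivAt G g τ := by
    intro τ hτ
    obtain ⟨e', he, hd⟩ := h.exists_hasDerivAt_pairing hθ hs hτ hδ
    refine ⟨e' - 1 / 2 * energy θ U s * 1 - 1 / 4 * (2 * energy θ U τ), by linarith, ?_⟩
    exact (hd.sub ((hasDerivAt_id τ).const_mul _)).sub ((hm τ).const_mul _)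
  have hanti : AntitoneOn G (Icc t s) := by
    refine antitoneOn_of_deriv_nonpos (convex_Icc t s) hGc.continuousOn ?_ ?_
    · intro τ hτ
      rw [interior_Icc] at hτ
      obtain ⟨g, -, hg⟩ := hGd τ hτ.2
      exact hg.differentiableAt.differentiableWithinAt
    · intro τ hτ
      rw [interior_Icc] at hτ
      obtain ⟨g, hg0, hg⟩ := hGd τ hτ.2
      rw [hg.deriv]; exact hg0
  have := hanti (left_mem_Icc.2 hts.le) (right_mem_Icc.2 hts.le) hts.le
  simp only [hG, hP] at this
  linarith

/-- The two-scale inequality which encodes the logarithmic convexity of the mass. -/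
lemma two_scale (h : IsStarHarmonic U D R) (hθ : IsProfile θ) {t s c : ℝ}
    (hs : Real.exp s < R) (hts : t < s) (hc : 0 < c) :
    3 / 4 * mass θ U s + 1 / 4 * mass θ U t - 1 / 2 * (s - t) * energy θ U s ≤
      1 / 2 * (mass θ U t / c + c * mass θ U s) := by
  have hcs : ∀ t : ℝ, Continuous fun y : EuclideanSpace ℝ (Fin d) => U (Real.exp t • y) :=
    fun t => h.continuous.comp (continuous_const_smul _)
  have hlim : ∀ τ : ℝ, Tendsto (fun δ => ∫ x, weight θ x * truncId δ (U (Real.exp s • x)) *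
      U (Real.exp τ • x)) (𝓝[>] 0)
      (𝓝 (∫ x, weight θ x * U (Real.exp s • x) * U (Real.exp τ • x))) := by
    intro τ
    refine tendsto_integral_filter_of_dominated_convergence
      (fun x => weight θ x * (|U (Real.exp s • x)| * |U (Real.exp τ • x)|))
      (Eventually.of_forall fun δ => ?_)
      (Eventually.of_forall fun δ => Eventually.of_forall fun x => ?_) ?_ ?_
    · exact ((hθ.continuous_weight.mul ((continuous_truncId δ).comp (hcs s))).mul
        (hcs τ)).aestronglyMeasurable
    · rw [norm_mul, norm_mul, Real.norm_of_nonneg (hθ.weight_nonneg x), mul_assoc]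
      exact mul_le_mul_of_nonneg_left (mul_le_mul_of_nonneg_right (abs_truncId_le _ _)
        (abs_nonneg _)) (hθ.weight_nonneg x)
    · exact hθ.integrable_weight_mul ((hcs s).abs.mul (hcs τ).abs)
    · exact Eventually.of_forall fun x => ((tendsto_truncId _).const_mul _).mul_const _
  have h1 := le_of_tendsto ((hlim s).sub (hlim t))
    (eventually_nhdsWithin_of_forall fun δ hδ => h.two_scale_truncId hθ hs hts hδ)
  have h2 : ∫ x, weight θ x * U (Real.exp s • x) * U (Real.exp s • x) = mass θ U s := by
    rw [mass]; congr 1; ext x; ring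
  have h3 : ∫ x, weight θ x * U (Real.exp s • x) * U (Real.exp t • x) ≤
      1 / 2 * (mass θ U t / c + c * mass θ U s) := by
    rw [mass, mass, ← integral_div, ← integral_const_mul, ← integral_add, ← integral_const_mul]
    · refine integral_mono ?_ ?_ fun x => ?_
      · simp only [mul_assoc]
        exact hθ.integrable_weight_mul ((hcs s).mul (hcs t))
      · exact (((hθ.integrable_weight_mul ((hcs t).pow 2)).div_const _).add
          ((hθ.integrable_weight_mul ((hcs s).pow 2)).const_mul _)).const_mul _
      · have hψ := hθ.weight_nonneg x
        have h4 : U (Real.exp s • x) * U (Real.exp t • x) ≤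
            1 / 2 * (U (Real.exp t • x) ^ 2 / c + c * U (Real.exp s • x) ^ 2) := by
          rw [← sub_nonneg]
          have : 1 / 2 * (U (Real.exp t • x) ^ 2 / c + c * U (Real.exp s • x) ^ 2) -
              U (Real.exp s • x) * U (Real.exp t • x) =
              (U (Real.exp t • x) - c * U (Real.exp s • x)) ^ 2 / (2 * c) := by
            field_simp; ring
          rw [this]; positivity
        calc weight θ x * U (Real.exp s • x) * U (Real.exp t • x)
            = weight θ x * (U (Real.exp s • x) * U (Real.exp t • x)) := by ring
          _ ≤ weight θ x * (1 / 2 * (U (Real.exp t • x) ^ 2 / c + c * U (Real.exp s • x) ^ 2)) :=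
              mul_le_mul_of_nonneg_left h4 hψ
          _ = _ := by ring
    · exact (hθ.integrable_weight_mul ((hcs t).pow 2)).div_const _
    · exact (hθ.integrable_weight_mul ((hcs s).pow 2)).const_mul _
  rw [h2] at h1
  linarith

end IsStarHarmonic

end Star

section QuasiConvex

lemma half_sub_le_exp_combination {x : ℝ} (hx : |x| ≤ 1 / 2) :
    1 / 2 * x - 3 * |x| ^ 3 ≤ 3 / 4 + 1 / 4 * Real.exp (-x) ^ 2 - Real.exp (-x) := by
  have h1 := Real.exp_bound (x := -x) (n := 3) (by rw [abs_neg]; linarith) (by norm_num)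
  have h2 := Real.exp_bound (x := -(2 * x)) (n := 3)
    (by rw [abs_neg, abs_mul, abs_two]; linarith) (by norm_num)
  have h3 : Real.exp (-(2 * x)) = Real.exp (-x) ^ 2 := by rw [← Real.exp_nat_mul]; ring_nf
  rw [h3] at h2
  rw [abs_neg, abs_le] at h1 h2
  rw [abs_mul, abs_two] at h2
  norm_num [Finset.sum_range_succ, Nat.factorial] at h1 h2
  nlinarith [pow_nonneg (abs_nonneg x) 3]

variable {q e : ℝ → ℝ} {T : ℝ}

/-- The two-scale inequality forces `q` to satisfy the maximum principle relative to every
exponential. -/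
lemma le_max_of_two_scale (hq : ∀ t, 0 ≤ q t) (hd : ∀ t, HasDerivAt q (2 * e t) t)
    (h2 : ∀ s < T, ∀ t < s, ∀ c > 0,
      3 / 4 * q s + 1 / 4 * q t - 1 / 2 * (s - t) * e s ≤ 1 / 2 * (q t / c + c * q s))
    {t₀ t₁ t₂ : ℝ} (h01 : t₀ < t₁) (h12 : t₁ < t₂) (hT : t₂ ≤ T) (a : ℝ) :
    q t₁ * Real.exp (-(a * t₁)) ≤
      max (q t₀ * Real.exp (-(a * t₀))) (q t₂ * Real.exp (-(a * t₂))) := by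
  by_contra! hcon
  set p : ℝ → ℝ → ℝ := fun κ t => q t * Real.exp (-(a * t) + κ * t ^ 2) with hp
  have hqc : Continuous q := continuous_iff_continuousAt.2 fun t => (hd t).continuousAt
  have hpκ : ∀ t, Tendsto (fun κ => p κ t) (𝓝[>] 0) (𝓝 (q t * Real.exp (-(a * t)))) := by
    intro t
    have : Continuous fun κ => p κ t := by simp only [hp]; fun_prop
    have h := (this.tendsto 0).mono_left (nhdsWithin_le_nhds (s := Ioi 0))
    simpa [hp] using h
  obtain ⟨κ, ⟨hκ0, hκ2⟩, hκ : 0 < κ⟩ := ((((hpκ t₀).eventually_lt (hpκ t₁)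
    ((le_max_left _ _).trans_lt hcon)).and ((hpκ t₂).eventually_lt (hpκ t₁)
    ((le_max_right _ _).trans_lt hcon))).and self_mem_nhdsWithin).exists
  have hpc : Continuous (p κ) := by simp only [hp]; fun_prop
  obtain ⟨s, hs, hmax⟩ := isCompact_Icc.exists_isMaxOn (nonempty_Icc.2 (h01.trans h12).le)
    hpc.continuousOn (s := Icc t₀ t₂)
  have hs1 : p κ t₁ ≤ p κ s := hmax ⟨h01.le, h12.le⟩
  have hs0 : t₀ < s := lt_of_le_of_ne hs.1 fun h => by rw [← h] at hs1; linarith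
  have hs2 : s < t₂ := lt_of_le_of_ne hs.2 fun h => by rw [h] at hs1; linarith
  have hqs : 0 < q s := by
    have h0 : 0 ≤ p κ t₀ := mul_nonneg (hq _) (Real.exp_pos _).le
    have h1 : 0 < p κ s := by linarith
    exact pos_of_mul_pos_left h1 (Real.exp_pos _).le
  obtain ⟨L, hL⟩ : ∃ L, L = (a - 2 * κ * s) / 2 := ⟨_, rfl⟩
  have hes : e s = L * q s := by
    have h1 : HasDerivAt (p κ) (2 * e s * Real.exp (-(a * s) + κ * s ^ 2) + q s *
        (Real.exp (-(a * s) + κ * s ^ 2) * (-(a * 1) + κ * (2 * s ^ 1 * 1)))) s :=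
      (hd s).mul ((((hasDerivAt_id s).const_mul a).neg.add
        (((hasDerivAt_id s).pow 2).const_mul κ)).exp)
    have h3 := (hmax.isLocalMax (Icc_mem_nhds hs0 hs2)).hasDerivAt_eq_zero h1
    have h4 := (Real.exp_pos (-(a * s) + κ * s ^ 2)).ne'
    have h5 : Real.exp (-(a * s) + κ * s ^ 2) *
        (2 * e s + q s * (-a + 2 * κ * s)) = 0 := by linarith
    have h6 := (mul_eq_zero.1 h5).resolve_left h4
    rw [hL]; linarith
  set M := |L| + κ with hM
  have hM0 : 0 < M := by positivity
  have hlim : ∀ A : ℝ, Tendsto (fun δ : ℝ => A * δ) (𝓝[>] 0) (𝓝 0) := fun A => by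
    have := ((continuous_const_mul A).tendsto 0).mono_left (nhdsWithin_le_nhds (s := Ioi 0))
    simpa using this
  obtain ⟨δ, ⟨⟨⟨hδ1, hδ2⟩, hδ3⟩, hδ4⟩, hδ : 0 < δ⟩ := ((((((hlim 1).eventually_lt_const
    (sub_pos.2 hs0)).and ((hlim 1).eventually_lt_const one_pos)).and
    ((hlim M).eventually_lt_const (one_half_pos))).and
    ((hlim (12 * M ^ 3)).eventually_lt_const hκ)).and self_mem_nhdsWithin).exists
  rw [one_mul] at hδ1 hδ2
  obtain ⟨x, hx⟩ : ∃ x, x = L * δ + κ * δ ^ 2 / 2 := ⟨_, rfl⟩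
  have hxM : |x| ≤ M * δ := by
    have h1 : |x| ≤ |L * δ| + |κ * δ ^ 2 / 2| := hx ▸ abs_add_le _ _
    rw [abs_mul, abs_of_pos hδ, abs_of_nonneg (by positivity : 0 ≤ κ * δ ^ 2 / 2)] at h1
    have h2 : κ * δ ^ 2 / 2 ≤ κ * δ := by nlinarith [mul_pos hκ hδ]
    rw [hM]; linarith
  have hxh : |x| ≤ 1 / 2 := hxM.trans (by linarith)
  have hx3 : |x| ^ 3 ≤ M ^ 3 * δ ^ 3 := by
    rw [← mul_pow]; exact pow_le_pow_left₀ (abs_nonneg _) hxM 3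
  have hf := half_sub_le_exp_combination hxh
  set z := Real.exp (-x) with hz
  have hz0 : 0 < z := Real.exp_pos _
  have hz2 : z ≤ 2 := by
    have h1 : -x ≤ Real.log 2 := by
      have := Real.log_two_gt_d9
      have := (abs_le.1 hxh).1
      linarith
    calc z ≤ Real.exp (Real.log 2) := Real.exp_le_exp.2 h1
      _ = 2 := Real.exp_log two_pos
  have hqt : q (s - δ) ≤ z ^ 2 * q s := by
    have h1 : p κ (s - δ) ≤ p κ s := hmax ⟨by linarith, by linarith⟩
    have h3 : Real.exp (-(a * s) + κ * s ^ 2) =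
        z ^ 2 * Real.exp (-(a * (s - δ)) + κ * (s - δ) ^ 2) := by
      rw [hz, ← Real.exp_nat_mul, ← Real.exp_add, hx, hL]; congr 1; push_cast; ring
    simp only [hp] at h1
    rw [h3] at h1
    have h4 := Real.exp_pos (-(a * (s - δ)) + κ * (s - δ) ^ 2)
    refine le_of_mul_le_mul_right ?_ h4
    linarith
  have h3 := h2 s (by linarith) (s - δ) (by linarith) z hz0
  rw [hes] at h3
  have h4 : (1 / (2 * z) - 1 / 4) * q (s - δ) ≤ (1 / (2 * z) - 1 / 4) * (z ^ 2 * q s) := by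
    refine mul_le_mul_of_nonneg_left hqt (sub_nonneg.2 ?_)
    exact one_div_le_one_div_of_le (by positivity) (by linarith)
  have h5 : (1 / (2 * z) - 1 / 4) * (z ^ 2 * q s) = (z / 2 - z ^ 2 / 4) * q s := by
    field_simp
  have h6 : (1 / (2 * z) - 1 / 4) * q (s - δ) = 1 / 2 * (q (s - δ) / z) - 1 / 4 * q (s - δ) := by
    field_simp
  have h7 : (3 / 4 + 1 / 4 * z ^ 2 - z - 1 / 2 * δ * L) * q s ≤ 0 := by
    rw [h5, h6] at h4
    have : s - (s - δ) = δ := by ring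
    rw [this] at h3
    linarith
  have h8 : 3 / 4 + 1 / 4 * z ^ 2 - z - 1 / 2 * δ * L ≤ 0 := by
    by_contra! h
    exact absurd h7 (not_le.2 (mul_pos h hqs))
  have h9 : κ * δ ^ 2 ≤ 12 * M ^ 3 * δ * δ ^ 2 := by nlinarith
  have h10 := mul_lt_mul_of_pos_right hδ4 (pow_pos hδ 2)
  linarith

/-- Three-point inequality for functions satisfying the maximum principle relative to every
exponential. -/
lemma log_three_point {p₀ p₁ p₂ t₀ t₁ t₂ : ℝ} (h0 : 0 ≤ p₀) (h1 : 0 < p₁) (h2 : 0 ≤ p₂)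
    (h01 : t₀ < t₁) (h12 : t₁ < t₂)
    (h : ∀ a : ℝ, p₁ * Real.exp (-(a * t₁)) ≤
      max (p₀ * Real.exp (-(a * t₀))) (p₂ * Real.exp (-(a * t₂)))) :
    0 < p₀ ∧ 0 < p₂ ∧ (t₂ - t₁) * (Real.log p₁ - Real.log p₀) ≤
      (t₁ - t₀) * (Real.log p₂ - Real.log p₁) := by
  have hlog : ∀ a, 0 < p₁ * Real.exp (-(a * t₁)) := fun a => by positivity
  have hp₂ : 0 < p₂ := by
    refine h2.lt_of_ne' fun hp => ?_
    have h3 := h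
    simp only [hp, zero_mul] at h3
    rcases h0.eq_or_lt with hp0 | hp0
    · have := h3 0
      have := hlog 0
      simp [← hp0] at *
      linarith
    · obtain ⟨a, ha⟩ : ∃ a, a = (Real.log p₁ - Real.log p₀ - 1) / (t₁ - t₀) := ⟨_, rfl⟩
      have h4 := h3 a
      rw [max_eq_left (by positivity)] at h4
      have h5 := Real.log_le_log (hlog a) h4
      rw [Real.log_mul h1.ne' (Real.exp_pos _).ne', Real.log_mul hp0.ne' (Real.exp_pos _).ne',
        Real.log_exp, Real.log_exp] at h5
      have h6 : a * (t₁ - t₀) = Real.log p₁ - Real.log p₀ - 1 := by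
        rw [ha, div_mul_cancel₀ _ (sub_pos.2 h01).ne']
      linarith
  have hp₀ : 0 < p₀ := by
    refine h0.lt_of_ne' fun hp => ?_
    obtain ⟨a, ha⟩ : ∃ a, a = (Real.log p₂ - Real.log p₁ + 1) / (t₂ - t₁) := ⟨_, rfl⟩
    have h4 := h a
    rw [hp, zero_mul, max_eq_right (by positivity)] at h4
    have h5 := Real.log_le_log (hlog a) h4
    rw [Real.log_mul h1.ne' (Real.exp_pos _).ne', Real.log_mul hp₂.ne' (Real.exp_pos _).ne',
      Real.log_exp, Real.log_exp] at h5
    have h6 : a * (t₂ - t₁) = Real.log p₂ - Real.log p₁ + 1 := by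
      rw [ha, div_mul_cancel₀ _ (sub_pos.2 h12).ne']
    linarith
  refine ⟨hp₀, hp₂, ?_⟩
  obtain ⟨a, ha⟩ : ∃ a, a = (Real.log p₂ - Real.log p₀) / (t₂ - t₀) := ⟨_, rfl⟩
  have h6 : a * (t₂ - t₀) = Real.log p₂ - Real.log p₀ := by
    rw [ha, div_mul_cancel₀ _ (sub_pos.2 (h01.trans h12)).ne']
  have h7 : Real.log p₁ - a * t₁ ≤ Real.log p₀ - a * t₀ := by
    have key : ∀ p t, 0 < p → Real.log (p * Real.exp (-(a * t))) = Real.log p - a * t := by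
      intro p t hp
      rw [Real.log_mul hp.ne' (Real.exp_pos _).ne', Real.log_exp, sub_eq_add_neg]
    rcases le_max_iff.1 (h a) with h4 | h4
    · have h5 := Real.log_le_log (hlog a) h4
      rwa [key _ _ h1, key _ _ hp₀] at h5
    · have h5 := Real.log_le_log (hlog a) h4
      rw [key _ _ h1, key _ _ hp₂] at h5
      linarith
  have h8 : Real.log p₁ - Real.log p₀ ≤ a * (t₁ - t₀) := by linarith
  have h9 : a * (t₂ - t₁) ≤ Real.log p₂ - Real.log p₁ := by linarith
  nlinarith [mul_le_mul_of_nonneg_left h8 (sub_pos.2 h12).le,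
    mul_le_mul_of_nonneg_left h9 (sub_pos.2 h01).le]

end QuasiConvex

section BallIntegrals

lemma exists_isProfile {b : ℝ} (hb : b < 1) :
    ∃ θ : ℝ → ℝ, IsProfile θ ∧ (∀ σ, -2 * deriv θ σ ≤ 1) ∧ (∀ σ ≤ b, -2 * deriv θ σ = 1) ∧
      ∀ σ, 1 ≤ σ → deriv θ σ = 0 := by
  set Ψ : ℝ → ℝ := fun σ => Real.smoothTransition ((1 - σ) / (1 - b)) with hΨ
  have hΨs : ContDiff ℝ 1 Ψ :=
    Real.smoothTransition.contDiff.comp ((contDiff_const.sub contDiff_id).div_const _)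
  have hb' : 0 < 1 - b := sub_pos.2 hb
  have hΨ0 : ∀ σ, 1 ≤ σ → Ψ σ = 0 := fun σ hσ =>
    Real.smoothTransition.zero_of_nonpos (div_nonpos_of_nonpos_of_nonneg (by linarith) hb'.le)
  have hder : ∀ σ, HasDerivAt (fun σ => -(1 / 2) * ∫ u in (1 : ℝ)..σ, Ψ u) (-(1 / 2) * Ψ σ) σ :=
    fun σ => (intervalIntegral.integral_hasDerivAt_right (hΨs.continuous.intervalIntegrable _ _)
      (hΨs.continuous.stronglyMeasurableAtFilter _ _) hΨs.continuous.continuousAt).const_mul _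
  refine ⟨fun σ => -(1 / 2) * ∫ u in (1 : ℝ)..σ, Ψ u, ⟨?_, ?_, fun σ => ?_⟩,
    fun σ => ?_, fun σ hσ => ?_, fun σ hσ => ?_⟩
  · refine (contDiff_succ_iff_deriv (n := 1)).2 ⟨fun σ => (hder σ).differentiableAt, by simp, ?_⟩
    rw [funext fun σ => (hder σ).deriv]
    exact contDiff_const.mul hΨs
  · intro σ hσ
    rw [intervalIntegral.integral_congr (g := fun _ => 0)]
    · simp
    · intro u hu
      rw [uIcc_of_le hσ] at hu
      exact hΨ0 u hu.1
  · rw [(hder σ).deriv]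
    have : 0 ≤ Ψ σ := Real.smoothTransition.nonneg _
    linarith
  · rw [(hder σ).deriv]
    have : Ψ σ ≤ 1 := Real.smoothTransition.le_one _
    linarith
  · rw [(hder σ).deriv]
    have : Ψ σ = 1 := Real.smoothTransition.one_of_one_le ((one_le_div hb').2 (by linarith))
    rw [this]; norm_num
  · rw [(hder σ).deriv, hΨ0 σ hσ, mul_zero]

variable {d : ℕ} {θ : ℝ → ℝ} {U : EuclideanSpace ℝ (Fin d) → ℝ}
  {D : Set (EuclideanSpace ℝ (Fin d))} {R : ℝ}

lemma IsProfile.integrable_weight_inv_smul_mul (hθ : IsProfile θ) (hU : Continuous U) {ρ : ℝ}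
    (hρ : 0 < ρ) : Integrable fun y => weight θ (ρ⁻¹ • y) * U y ^ 2 := by
  have h := (hθ.integrable_weight_mul (g := fun y => U (ρ • y) ^ 2) (by fun_prop)).comp_smul
    (inv_ne_zero hρ.ne')
  simpa [smul_smul, hρ.ne'] using h

lemma integrableOn_ball_sq (hU : Continuous U) (v : EuclideanSpace ℝ (Fin d)) (r : ℝ) :
    IntegrableOn (fun y => U y ^ 2) (ball v r) :=
  ((hU.pow 2).continuousOn.integrableOn_compact (isCompact_closedBall v r)).mono_set
    ball_subset_closedBall

lemma integral_weight_le_setIntegral (hθ : IsProfile θ) (hθ1 : ∀ σ, -2 * deriv θ σ ≤ 1)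
    (hθ0 : ∀ σ, 1 ≤ σ → deriv θ σ = 0) (hU : Continuous U) {ρ : ℝ} (hρ : 0 < ρ)
    {v : EuclideanSpace ℝ (Fin d)} {r : ℝ} (hball : ball 0 ρ ⊆ ball v r) :
    ∫ y, weight θ (ρ⁻¹ • y) * U y ^ 2 ≤ ∫ y in ball v r, U y ^ 2 := by
  rw [← setIntegral_eq_integral_of_forall_compl_eq_zero (s := ball v r)]
  · exact setIntegral_mono_on (hθ.integrable_weight_inv_smul_mul hU hρ).integrableOn
      (integrableOn_ball_sq hU v r) measurableSet_ball fun y _ =>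
        mul_le_of_le_one_left (sq_nonneg _) (hθ1 _)
  · intro y hy
    have h1 : ρ ≤ ‖y‖ := by
      by_contra! h
      exact hy (hball (by simpa using h))
    have h2 : 1 ≤ ‖ρ⁻¹ • y‖ := by
      rw [norm_smul, Real.norm_of_nonneg (by positivity), inv_mul_eq_div]
      exact (one_le_div hρ).2 h1
    rw [weight, hθ0 _ (one_le_pow₀ h2), mul_zero, zero_mul]

lemma setIntegral_le_integral_weight {j : ℝ} (hθ : IsProfile θ)
    (hθj : ∀ σ ≤ (j⁻¹) ^ 2, -2 * deriv θ σ = 1)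
    (hU : Continuous U) {ρ : ℝ} (hρ : 0 < ρ) {v : EuclideanSpace ℝ (Fin d)} {r : ℝ}
    (hball : ball v r ⊆ ball 0 (ρ / j)) :
    ∫ y in ball v r, U y ^ 2 ≤ ∫ y, weight θ (ρ⁻¹ • y) * U y ^ 2 := by
  have hint := hθ.integrable_weight_inv_smul_mul hU hρ
  calc ∫ y in ball v r, U y ^ 2 = ∫ y in ball v r, weight θ (ρ⁻¹ • y) * U y ^ 2 := by
        refine setIntegral_congr_fun measurableSet_ball fun y hy => ?_
        have h1 : ‖y‖ < ρ / j := by simpa using hball hy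
        have h2 : ‖ρ⁻¹ • y‖ ≤ j⁻¹ := by
          rw [norm_smul, Real.norm_of_nonneg (by positivity), inv_mul_le_iff₀ hρ]
          exact h1.le.trans_eq (div_eq_mul_inv _ _)
        rw [weight, hθj _ (pow_le_pow_left₀ (norm_nonneg _) h2 2), one_mul]
    _ ≤ _ := setIntegral_le_integral hint (Eventually.of_forall fun y =>
        mul_nonneg (hθ.weight_nonneg _) (sq_nonneg _))

lemma IsStarHarmonic.integral_weight_le_max (h : IsStarHarmonic U D R) (hθ : IsProfile θ)
    {t₀ t₁ t₂ : ℝ} (h01 : t₀ < t₁) (h12 : t₁ < t₂) (hT : Real.exp t₂ ≤ R) (a : ℝ) :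
    (∫ y, weight θ (Real.exp (-t₁) • y) * U y ^ 2) * Real.exp (-(a * t₁)) ≤
      max ((∫ y, weight θ (Real.exp (-t₀) • y) * U y ^ 2) * Real.exp (-(a * t₀)))
        ((∫ y, weight θ (Real.exp (-t₂) • y) * U y ^ 2) * Real.exp (-(a * t₂))) := by
  have hm : ∀ t, mass θ U t * Real.exp (-((a - d) * t)) =
      (∫ y, weight θ (Real.exp (-t) • y) * U y ^ 2) * Real.exp (-(a * t)) := by
    intro t
    rw [mass_eq, mul_right_comm, ← Real.exp_add, mul_comm]
    congr 2; ring
  have := le_max_of_two_scale (q := mass θ U) (e := energy θ U) (T := t₂)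
    (fun t => integral_nonneg fun x => mul_nonneg (hθ.weight_nonneg _) (sq_nonneg _))
    (hasDerivAt_mass hθ h.continuous)
    (fun s hs t hts c hc => h.two_scale hθ ((Real.exp_lt_exp.2 hs).trans_le hT) hts hc)
    h01 h12 le_rfl (a - d)
  simpa only [hm] using this

/-- Logarithmic convexity for the integrals of `U ^ 2` over balls which are nearly concentric
with the center of the star. -/
lemma IsStarHarmonic.log_setIntegral_le (h : IsStarHarmonic U D R) {j ρ₀ ρ₁ ρ₂ r₀ r₁ r₂ : ℝ}
    {v : EuclideanSpace ℝ (Fin d)} (hj : 1 < j) (hρ₀ : 0 < ρ₀) (h01 : ρ₀ < ρ₁) (h12 : ρ₁ < ρ₂)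
    (h2R : ρ₂ ≤ R) (hb₀ : ball 0 ρ₀ ⊆ ball v r₀) (hb₁ : ball v r₁ ⊆ ball 0 (ρ₁ / j))
    (hb₂ : ball 0 ρ₂ ⊆ ball v r₂) (hpos : 0 < ∫ y in ball v r₁, U y ^ 2) :
    (Real.log ρ₂ - Real.log ρ₁) *
        (Real.log (∫ y in ball v r₁, U y ^ 2) - Real.log (∫ y in ball v r₀, U y ^ 2)) ≤
      (Real.log ρ₁ - Real.log ρ₀) *
        (Real.log (∫ y in ball v r₂, U y ^ 2) - Real.log (∫ y in ball v r₁, U y ^ 2)) := by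
  obtain ⟨θ, hθ, hθ1, hθj, hθ0⟩ := exists_isProfile (b := (j⁻¹) ^ 2)
    (pow_lt_one₀ (by positivity) (inv_lt_one_of_one_lt₀ hj) two_ne_zero)
  have hρ₁ := hρ₀.trans h01
  have hρ₂ := hρ₁.trans h12
  have hU := h.continuous
  set P : ℝ → ℝ := fun ρ => ∫ y, weight θ (ρ⁻¹ • y) * U y ^ 2 with hP
  have hPn : ∀ ρ, 0 ≤ P ρ := fun ρ =>
    integral_nonneg fun x => mul_nonneg (hθ.weight_nonneg _) (sq_nonneg _)
  have hP0 := integral_weight_le_setIntegral hθ hθ1 hθ0 hU hρ₀ hb₀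
  have hP2 := integral_weight_le_setIntegral hθ hθ1 hθ0 hU hρ₂ hb₂
  have hP1 := setIntegral_le_integral_weight hθ hθj hU hρ₁ hb₁
  have hexp : ∀ ρ, 0 < ρ → Real.exp (-Real.log ρ) = ρ⁻¹ := fun ρ hρ => by
    rw [Real.exp_neg, Real.exp_log hρ]
  obtain ⟨h0, h2, h3⟩ := log_three_point (hPn ρ₀) (hpos.trans_le hP1) (hPn ρ₂)
    (Real.log_lt_log hρ₀ h01) (Real.log_lt_log hρ₁ h12) fun a => by
      have := h.integral_weight_le_max hθ (Real.log_lt_log hρ₀ h01) (Real.log_lt_log hρ₁ h12)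
        ((Real.exp_log hρ₂).trans_le h2R) a
      rwa [hexp _ hρ₀, hexp _ hρ₁, hexp _ hρ₂] at this
  have hl0 := Real.log_le_log h0 hP0
  have hl1 := Real.log_le_log hpos hP1
  have hl2 := Real.log_le_log h2 hP2
  refine (mul_le_mul_of_nonneg_left ?_ (sub_pos.2 (Real.log_lt_log hρ₁ h12)).le).trans
    (h3.trans (mul_le_mul_of_nonneg_left ?_ (sub_pos.2 (Real.log_lt_log hρ₀ h01)).le)) <;> linarith

end BallIntegrals

section Coordinates

variable {m : ℕ}

lemma front_add (y z : Euc m) : front (y + z) = front y + front z := rfl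

lemma front_smul (c : ℝ) (y : Euc m) : front (c • y) = c • front y := rfl

lemma lastC_add (y z : Euc m) : lastC (y + z) = lastC y + lastC z := rfl

lemma lastC_smul (c : ℝ) (y : Euc m) : lastC (c • y) = c * lastC y := rfl

lemma front_eLast : front (eLast m) = 0 := by
  ext i
  simp [front, eLast]

lemma lastC_eLast : lastC (eLast m) = 1 := by simp [lastC, eLast]

lemma norm_eLast : ‖eLast m‖ = 1 := by simp [eLast]

lemma norm_front_le (y : Euc m) : ‖front y‖ ≤ ‖y‖ := by
  rw [EuclideanSpace.norm_eq, EuclideanSpace.norm_eq, Fin.sum_univ_castSucc (n := m)]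
  exact Real.sqrt_le_sqrt (le_add_of_nonneg_right (sq_nonneg _))

lemma continuous_front : Continuous (front : Euc m → EuclideanSpace ℝ (Fin m)) := by
  refine (PiLp.continuous_toLp 2 _).comp ?_
  fun_prop

lemma continuous_lastC : Continuous (lastC : Euc m → ℝ) := by
  unfold lastC; fun_prop

/-- The region above a Lipschitz graph is star-shaped, at the scale `r`, with respect to points
at height at least `2 * τ * r` above the graph. -/
lemma lt_lastC_add_smul {τ : ℝ≥0} {f : EuclideanSpace ℝ (Fin m) → ℝ} {R r s c : ℝ}
    (hf : LipschitzOnWith τ f (ball 0 R)) {p w : Euc m} (hpw : ‖p‖ + ‖w‖ < R) (hw : ‖w‖ ≤ r)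
    (hs : 2 * τ * r ≤ s) (hp : f (front p) + s ≤ lastC p) (hc : 0 < c) (hc1 : c ≤ 1)
    (h : f (front (p + w)) < lastC (p + w)) : f (front (p + c • w)) < lastC (p + c • w) := by
  have hmem : ∀ b : ℝ, 0 ≤ b → b ≤ 1 → front (p + b • w) ∈ ball 0 R := by
    intro b hb hb1
    rw [mem_ball_zero_iff]
    calc ‖front (p + b • w)‖ ≤ ‖p + b • w‖ := norm_front_le _
      _ ≤ ‖p‖ + ‖b • w‖ := norm_add_le _ _
      _ ≤ ‖p‖ + ‖w‖ := by
        rw [norm_smul, Real.norm_of_nonneg hb]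
        gcongr
        exact mul_le_of_le_one_left (norm_nonneg _) hb1
      _ < R := hpw
  have hc' := hmem c hc.le hc1
  have hlip : ∀ b : ℝ, 0 ≤ b → b ≤ 1 →
      f (front (p + c • w)) ≤ f (front (p + b • w)) + τ * (|c - b| * r) := by
    intro b hb hb1
    have h1 := hf.dist_le_mul _ hc' _ (hmem b hb hb1)
    have h2 : dist (front (p + c • w)) (front (p + b • w)) = |c - b| * ‖front w‖ := by
      rw [dist_eq_norm, front_add, front_add, add_sub_add_left_eq_sub, front_smul, front_smul,
        ← sub_smul, norm_smul, Real.norm_eq_abs]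
    rw [h2, Real.dist_eq] at h1
    have h3 : |c - b| * ‖front w‖ ≤ |c - b| * r :=
      mul_le_mul_of_nonneg_left ((norm_front_le w).trans hw) (abs_nonneg _)
    have h4 := mul_le_mul_of_nonneg_left h3 τ.coe_nonneg
    linarith [le_abs_self (f (front (p + c • w)) - f (front (p + b • w)))]
  have h0 := hlip 0 le_rfl zero_le_one
  have h1 := hlip 1 zero_le_one le_rfl
  rw [zero_smul, add_zero, sub_zero, abs_of_pos hc] at h0
  rw [one_smul, abs_of_nonpos (by linarith)] at h1
  rw [lastC_add] at h ⊢
  rw [lastC_smul]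
  have hτr : 0 ≤ τ * r := mul_nonneg τ.coe_nonneg ((norm_nonneg _).trans hw)
  have hcs : c * (2 * τ * r) ≤ s := by nlinarith
  nlinarith [mul_le_mul_of_nonneg_left h0 (sub_nonneg.2 hc1), mul_le_mul_of_nonneg_left h1 hc.le,
    mul_lt_mul_of_pos_left h hc, mul_le_mul_of_nonneg_left hp (sub_nonneg.2 hc1),
    mul_le_mul_of_nonneg_left hcs (sub_nonneg.2 hc1)]

end Coordinates

section Extension

variable {d : ℕ} {Ω : Set (EuclideanSpace ℝ (Fin d))} {h : EuclideanSpace ℝ (Fin d) → ℝ}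
  {p : EuclideanSpace ℝ (Fin d)} {ρ : ℝ}

/-- The extension by zero of a cut-off of `h` around `p`, in coordinates centered at `p`. -/
def zeroExtension (Ω : Set (EuclideanSpace ℝ (Fin d))) (h : EuclideanSpace ℝ (Fin d) → ℝ)
    {p : EuclideanSpace ℝ (Fin d)} (χ : ContDiffBump p) (z : EuclideanSpace ℝ (Fin d)) : ℝ :=
  Ω.indicator (fun y => χ y * h y) (p + z)

lemma zeroExtension_eq (χ : ContDiffBump p) {z : EuclideanSpace ℝ (Fin d)}
    (hz : ‖z‖ < χ.rIn) : zeroExtension Ω h χ z = Ω.indicator h (p + z) := by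
  have : χ (p + z) = 1 := χ.one_of_mem_closedBall (by simpa using hz.le)
  simp [zeroExtension, indicator, this]

lemma isStarHarmonic_zeroExtension (hΩ : IsOpen Ω) (hc : ContinuousOn h (closure Ω))
    (hh : IsHarmonicOn h Ω) (χ : ContDiffBump p)
    (h0 : ∀ y ∈ frontier Ω ∩ ball p χ.rOut, h y = 0)
    (hstar : ∀ z, ‖z‖ < χ.rIn → p + z ∈ Ω → ∀ c : ℝ, 0 < c → c ≤ 1 → p + c • z ∈ Ω) :
    IsStarHarmonic (zeroExtension Ω h χ) {z | ‖z‖ < χ.rIn ∧ p + z ∈ Ω} χ.rIn := by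
  have hopen : IsOpen {z | ‖z‖ < χ.rIn ∧ p + z ∈ Ω} :=
    (isOpen_lt continuous_norm continuous_const).inter (hΩ.preimage (continuous_const_add p))
  have heq : EqOn (zeroExtension Ω h χ) (fun z => h (p + z)) {z | ‖z‖ < χ.rIn ∧ p + z ∈ Ω} :=
    fun z hz => by rw [zeroExtension_eq χ hz.1, indicator_of_mem hz.2]
  refine ⟨?_, hopen, ?_, ?_, ?_, ?_⟩
  · refine Continuous.comp (continuous_indicator (fun y hy => ?_)
      (χ.continuous.continuousOn.mul hc)) (continuous_const_add p)
    by_cases hyb : y ∈ ball p χ.rOut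
    · rw [h0 y ⟨hy, hyb⟩, mul_zero]
    · rw [χ.zero_of_le_dist (by simpa using hyb), zero_mul]
  · rintro z ⟨hz, hzΩ⟩ c hc hc1
    refine ⟨?_, hstar z hz hzΩ c hc hc1⟩
    rw [norm_smul, Real.norm_of_nonneg hc.le]
    exact (mul_le_of_le_one_left (norm_nonneg _) hc1).trans_lt hz
  · exact fun z hz hne => ⟨hz, mem_of_indicator_ne_zero hne⟩
  · exact (hh.1.comp (contDiff_const.add contDiff_id).contDiffOn fun z hz => hz.2).congr heq
  · intro z hz
    have h1 : zeroExtension Ω h χ =ᶠ[𝓝 z] fun z => h (p + z) :=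
      heq.eventuallyEq_of_mem (hopen.mem_nhds hz)
    have h2 : fderiv ℝ (fun z => h (p + z)) = fun z => fderiv ℝ h (p + z) :=
      funext fun z => fderiv_comp_add_left p
    have h3 : fderiv ℝ (fderiv ℝ (zeroExtension Ω h χ)) z = fderiv ℝ (fderiv ℝ h) (p + z) := by
      rw [h1.fderiv.fderiv_eq, h2, fderiv_comp_add_left]
    have h4 := hh.2 _ hz.2
    simp only [lap, iteratedFDeriv_two_apply] at h4
    simpa [h3] using h4

lemma Hh_eq_setIntegral_zeroExtension (hΩ : IsOpen Ω) (χ : ContDiffBump p)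
    {v : EuclideanSpace ℝ (Fin d)} (hv : ball v ρ ⊆ ball 0 χ.rIn) :
    Hh Ω h (p + v) ρ = ∫ z in ball v ρ, zeroExtension Ω h χ z ^ 2 := by
  rw [Hh, ← integral_indicator (measurableSet_ball.inter hΩ.measurableSet),
    ← integral_indicator measurableSet_ball, ← integral_add_left_eq_self _ p]
  congr 1
  ext z
  have hz : p + z ∈ ball (p + v) ρ ↔ z ∈ ball v ρ := by simp
  by_cases h1 : z ∈ ball v ρ
  · rw [indicator_of_mem h1, zeroExtension_eq χ (by simpa using hv h1)]
    by_cases h2 : p + z ∈ Ω <;> simp [indicator, h2, hz.2 h1, -mem_ball]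
  · rw [indicator_of_notMem h1, indicator_of_notMem fun h2 => h1 (hz.1 h2.1)]

end Extension

section Reduction

variable {m : ℕ} {Ω : Set (Euc m)} {h : Euc m → ℝ}

lemma LipGraph.exists_star_center {τ : ℝ≥0} {x x₀ : Euc m} {R r : ℝ} (hL : LipGraph Ω τ x R)
    (hx₀ : x₀ ∈ closure Ω ∩ ball x (R / 4)) (hr : 0 < r) (hrR : r < R / 16)
    (hτ : 10 * (τ : ℝ) ≤ 1) :
    ∃ p, ‖x₀ - p‖ = 10 * τ * r ∧ ball p (6 * r) ⊆ ball x R ∧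
      ∀ z, ‖z‖ < 5 * r → p + z ∈ Ω → ∀ c : ℝ, 0 < c → c ≤ 1 → p + c • z ∈ Ω := by
  obtain ⟨T, f, hT0, hf, -, hΩ⟩ := hL
  have hball : ∀ y, T y ∈ ball x R ↔ y ∈ ball 0 R := fun y => by
    rw [mem_ball, mem_ball, ← hT0, T.dist_eq]
  have hmem : ∀ y ∈ ball 0 R, (T y ∈ Ω ↔ f (front y) < lastC y) := by
    intro y hy
    constructor
    · intro h1
      have h2 : T y ∈ Ω ∩ ball x R := ⟨h1, (hball y).2 hy⟩
      rw [hΩ] at h2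
      obtain ⟨y', hy', he⟩ := h2
      rw [← T.injective he]
      exact hy'.2
    · intro h1
      have h2 : T y ∈ Ω ∩ ball x R := by rw [hΩ]; exact ⟨y, ⟨hy, h1⟩, rfl⟩
      exact h2.1
  obtain ⟨y₀, rfl⟩ := T.surjective x₀
  have hy₀ : ‖y₀‖ < R / 4 := by
    have := hx₀.2
    rwa [mem_ball, ← hT0, T.dist_eq, dist_zero_right] at this
  have hR : 0 < R := by linarith
  have hgraph : f (front y₀) ≤ lastC y₀ := by
    have hyR : y₀ ∈ ball (0 : Euc m) R := mem_ball_zero_iff.2 (by linarith)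
    have hcl : y₀ ∈ closure (ball 0 R ∩ T ⁻¹' Ω) :=
      isOpen_ball.inter_closure ⟨hyR, by
        have h1 : y₀ ∈ T ⁻¹' closure Ω := hx₀.1
        rwa [← T.coe_toHomeomorph, T.toHomeomorph.preimage_closure] at h1⟩
    have hfc : ContinuousOn (fun y : Euc m => f (front y)) (ball 0 R) :=
      hf.continuousOn.comp continuous_front.continuousOn fun y hy =>
        mem_ball_zero_iff.2 ((norm_front_le y).trans_lt (mem_ball_zero_iff.1 hy))
    exact ContinuousWithinAt.closure_le hcl ((hfc y₀ hyR).mono inter_subset_left)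
      continuous_lastC.continuousWithinAt fun y hy => ((hmem y hy.1).1 hy.2).le
  set s : ℝ := 10 * τ * r with hs
  have hs0 : 0 ≤ s := by positivity
  have hsr : s ≤ r := by rw [hs]; nlinarith
  set y₁ := y₀ + s • eLast m with hy₁
  have hy₁n : ‖y₁‖ ≤ ‖y₀‖ + s := by
    refine (norm_add_le _ _).trans_eq ?_
    rw [norm_smul, norm_eLast, mul_one, Real.norm_of_nonneg hs0]
  set A := T.toRealAffineIsometryEquiv with hA
  have hAT : ∀ y, A y = T y := fun y => by rw [hA, T.coeFn_toRealAffineIsometryEquiv]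
  have hadd : ∀ z, T y₁ + z = T (y₁ + A.linearIsometryEquiv.symm z) := by
    intro z
    have h1 := A.map_vadd y₁ (A.linearIsometryEquiv.symm z)
    rw [A.linearIsometryEquiv.apply_symm_apply, vadd_eq_add, vadd_eq_add, hAT, hAT] at h1
    rw [add_comm y₁, h1, add_comm]
  refine ⟨T y₁, ?_, ?_, ?_⟩
  · rw [← dist_eq_norm, T.dist_eq, hy₁, dist_self_add_right, norm_smul, norm_eLast, mul_one,
      Real.norm_of_nonneg hs0]
  · refine ball_subset_ball' ?_
    rw [← hT0, T.dist_eq, dist_zero_right]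
    linarith
  · intro z hz hzΩ c hc hc1
    set w := A.linearIsometryEquiv.symm z with hw
    have hwn : ‖w‖ = ‖z‖ := A.linearIsometryEquiv.symm.norm_map z
    have hin : ∀ b : ℝ, 0 ≤ b → b ≤ 1 → y₁ + b • w ∈ ball 0 R := by
      intro b hb hb1
      rw [mem_ball_zero_iff]
      refine (norm_add_le _ _).trans_lt ?_
      rw [norm_smul, Real.norm_of_nonneg hb, hwn]
      have := mul_le_of_le_one_left (norm_nonneg z) hb1
      linarith
    rw [hadd] at hzΩ ⊢
    have h1 := hin 1 zero_le_one le_rfl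
    rw [one_smul] at h1
    rw [map_smul, hmem _ (hin c hc.le hc1)]
    rw [hmem _ h1] at hzΩ
    refine lt_lastC_add_smul (r := 5 * r) (s := s) hf (by linarith) (by linarith)
      (by rw [hs]; linarith) ?_ hc hc1 hzΩ
    rw [hy₁, front_add, front_smul, front_eLast, smul_zero, add_zero, lastC_add, lastC_smul,
      lastC_eLast, mul_one]
    linarith

lemma Hh_mono (hc : ContinuousOn h (closure Ω)) (x₀ : Euc m) {r₁ r₂ : ℝ}
    (hr : r₁ ≤ r₂) : Hh Ω h x₀ r₁ ≤ Hh Ω h x₀ r₂ := by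
  have hint : IntegrableOn (fun y => h y ^ 2) (ball x₀ r₂ ∩ Ω) :=
    (((hc.pow 2).mono inter_subset_right).integrableOn_compact
      ((isCompact_closedBall x₀ r₂).inter_right isClosed_closure)).mono_set
      (inter_subset_inter ball_subset_closedBall subset_closure)
  exact setIntegral_mono_set hint (Eventually.of_forall fun y => sq_nonneg _)
    (inter_subset_inter_left _ (ball_subset_ball hr)).eventuallyLE

lemma Hh_nonneg (x₀ : Euc m) (r : ℝ) : 0 ≤ Hh Ω h x₀ r :=
  integral_nonneg fun _ => sq_nonneg _

lemma Nh_nonneg (hc : ContinuousOn h (closure Ω)) (x₀ : Euc m) {r : ℝ}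
    (hr : 0 ≤ r) : 0 ≤ Nh Ω h x₀ r := by
  rcases (Hh_nonneg (Ω := Ω) (h := h) x₀ r).eq_or_lt with h0 | h0
  · simp [Nh, ← h0]
  · exact Real.log_nonneg ((one_le_div h0).2 (Hh_mono hc x₀ (by linarith)))

/-- The monotonicity of the doubling index with explicit constants, where `μ` measures the
flatness of the boundary. -/
lemma Nh_le_of_lipGraph (hΩ : IsOpen Ω) (hc : ContinuousOn h (closure Ω))
    (hh : IsHarmonicOn h Ω) {τ : ℝ≥0} {x x₀ : Euc m} {R r μ : ℝ} (hL : LipGraph Ω τ x R)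
    (h0 : ∀ y ∈ frontier Ω ∩ ball x R, h y = 0) (hx₀ : x₀ ∈ closure Ω ∩ ball x (R / 4))
    (hr : 0 < r) (hrR : r < R / 16) (hμ : 0 < μ) (hμ2 : 4 * μ < Real.log 2)
    (hτ : 10 * (τ : ℝ) ≤ 1 - (Real.exp μ)⁻¹) :
    (Real.log 2 - 4 * μ) * Nh Ω h x₀ r ≤ (Real.log 2 + 4 * μ) * Nh Ω h x₀ (2 * r) := by
  have hl2 := Real.log_pos one_lt_two
  rcases (Hh_nonneg (Ω := Ω) (h := h) x₀ r).eq_or_lt with hH | hH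
  · have h1 : Nh Ω h x₀ r = 0 := by simp [Nh, ← hH]
    rw [h1, mul_zero]
    exact mul_nonneg (by linarith) (Nh_nonneg hc x₀ (by linarith))
  set j := Real.exp μ with hj
  have hj1 : 1 < j := Real.one_lt_exp_iff.2 hμ
  have hj0 : 0 < j := one_pos.trans hj1
  have hji : 0 < j⁻¹ := inv_pos.2 hj0
  have hji1 : j⁻¹ < 1 := inv_lt_one_of_one_lt₀ hj1
  have hj4 : j ^ 4 < 2 := by
    rw [hj, ← Real.exp_nat_mul, ← Real.lt_log_iff_exp_lt two_pos]
    push_cast; exact hμ2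
  obtain ⟨p, hpn, hpR, hstar⟩ := hL.exists_star_center hx₀ hr hrR (by linarith)
  set χ : ContDiffBump p := ⟨5 * r, 6 * r, by positivity, by linarith⟩ with hχ
  have hU := isStarHarmonic_zeroExtension hΩ hc hh χ
    (fun y hy => h0 y ⟨hy.1, hpR hy.2⟩) hstar
  set v := x₀ - p with hv
  have hvr : ‖v‖ ≤ (1 - j⁻¹) * r := by
    rw [hpn]; exact mul_le_mul_of_nonneg_right hτ hr.le
  have hvr' : ‖v‖ ≤ r - j⁻¹ * r := by linarith
  have hjr : 0 < j⁻¹ * r := mul_pos hji hr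
  have hHh : ∀ ρ ≤ 4 * r, Hh Ω h x₀ ρ = ∫ z in ball v ρ, zeroExtension Ω h χ z ^ 2 := by
    intro ρ hρ
    rw [← Hh_eq_setIntegral_zeroExtension hΩ χ, hv, add_sub_cancel]
    refine ball_subset_ball' ?_
    rw [dist_zero_right]
    show ρ + ‖v‖ ≤ 5 * r
    linarith
  have hjr1 : j⁻¹ * r ≤ r := mul_le_of_le_one_left hr.le hji1.le
  have hjj : (j ^ 2)⁻¹ * r ≤ j⁻¹ * r := by
    rw [← inv_pow]
    exact mul_le_mul_of_nonneg_right (pow_le_of_le_one hji.le hji1.le two_ne_zero) hr.le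
  have hj2 : (j ^ 2)⁻¹ * r * j ^ 2 = r := by field_simp
  have hj3 : 0 < (j ^ 2)⁻¹ * r := by positivity
  have hH1 := hH.trans_le (Hh_mono hc x₀ (by linarith : r ≤ 2 * r))
  have hH2 := hH1.trans_le (Hh_mono hc x₀ (by linarith : 2 * r ≤ 2 * (2 * r)))
  have key := hU.log_setIntegral_le (j := j) (ρ₀ := (j ^ 2)⁻¹ * r) (ρ₁ := 2 * r * j ^ 2)
    (ρ₂ := 4 * ((j ^ 2)⁻¹ * r)) (r₀ := r) (r₁ := 2 * r) (r₂ := 2 * (2 * r)) (v := v) hj1 hj3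
    (by nlinarith [mul_lt_mul_of_pos_left (one_lt_pow₀ hj1 two_ne_zero) hr])
    (by
      have : 4 * ((j ^ 2)⁻¹ * r) * j ^ 2 = 4 * r := by linarith
      have h2 : 0 < j ^ 2 := by positivity
      refine lt_of_mul_lt_mul_right ?_ h2.le
      nlinarith)
    (by show _ ≤ 5 * r; linarith)
    (by
      refine ball_subset_ball' ?_
      rw [dist_zero_left]
      linarith)
    (by
      refine ball_subset_ball' ?_
      rw [dist_zero_right]
      have : 2 * r * j ^ 2 / j = 2 * r * j := by field_simp
      rw [this]
      have h3 : j⁻¹ * j = 1 := inv_mul_cancel₀ hj0.ne'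
      nlinarith [mul_nonneg (sub_nonneg.2 hj1.le) (sub_nonneg.2 hji1.le)])
    (by
      refine ball_subset_ball' ?_
      rw [dist_zero_left]
      linarith)
    (by rw [← hHh _ (by linarith)]; exact hH1)
  rw [← hHh _ (by linarith), ← hHh _ (by linarith), ← hHh _ (by linarith)] at key
  have hlj : Real.log (j ^ 2) = 2 * μ := by rw [Real.log_pow, hj, Real.log_exp]; norm_num
  have hl4 : Real.log 4 = 2 * Real.log 2 := by
    rw [show (4 : ℝ) = 2 ^ 2 by norm_num, Real.log_pow]; norm_num
  rw [Real.log_mul four_ne_zero hj3.ne', Real.log_mul (by positivity) hr.ne', Real.log_inv,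
    Real.log_mul (by positivity) (by positivity), Real.log_mul two_ne_zero hr.ne',
    hlj, hl4] at key
  rw [Nh, Nh, Real.log_div hH1.ne' hH.ne', Real.log_div hH2.ne' hH1.ne']
  convert key using 2 <;> ring

end Reduction

/-- (Almost monotonicity of the doubling index, Lemma 3.2.) Let `Ω ⊂ ℝ^d`
be a domain. For any `ε > 0` there exists `τ_ε > 0` such that: if `τ < τ_ε`,
`∂Ω ∩ B(x,R) ∈ Lip(τ)` with `x ∈ ∂Ω`, and `h` is a nonzero function continuous on
`closure Ω`, harmonic in `Ω`, vanishing on `∂Ω ∩ B(x,R)`, then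
`N_h(x₀,r) ≤ (1+ε) N_h(x₀,2r)` for all `x₀ ∈ closure Ω ∩ B(x,R/4)` and `0 < r < R/16`. -/
theorem stmt_6 (m : ℕ) (Ω : Set (Euc m)) (hΩ : IsOpen Ω) (hconn : IsConnected Ω)
    (ε : ℝ) (hε : 0 < ε) :
    ∃ τε : ℝ≥0, 0 < τε ∧
      ∀ (τ : ℝ≥0) (x : Euc m) (R : ℝ), 0 < τ → τ < τε → x ∈ frontier Ω → 0 < R →
        LipGraph Ω τ x R →
        ∀ h : Euc m → ℝ, ContinuousOn h (closure Ω) → IsHarmonicOn h Ω →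
          (∃ y ∈ Ω, h y ≠ 0) →
          (∀ y ∈ frontier Ω ∩ ball x R, h y = 0) →
          ∀ x₀ ∈ closure Ω ∩ ball x (R / 4), ∀ r : ℝ, 0 < r → r < R / 16 →
            Nh Ω h x₀ r ≤ (1 + ε) * Nh Ω h x₀ (2 * r) := by
  have hl2 := Real.log_pos one_lt_two
  set μ : ℝ := ε * Real.log 2 / (4 * (2 + ε)) with hμdef
  have hμ : 0 < μ := by positivity
  have hμε : Real.log 2 + 4 * μ = (1 + ε) * (Real.log 2 - 4 * μ) := by
    rw [hμdef]; field_simp; ring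
  have hμ2 : 0 < Real.log 2 - 4 * μ := by
    refine pos_of_mul_pos_right ?_ (by positivity : 0 ≤ 1 + ε)
    rw [← hμε]; positivity
  have hj : 0 < 1 - (Real.exp μ)⁻¹ :=
    sub_pos.2 (inv_lt_one_of_one_lt₀ (Real.one_lt_exp_iff.2 hμ))
  refine ⟨⟨(1 - (Real.exp μ)⁻¹) / 10, by positivity⟩, ?_, ?_⟩
  · exact NNReal.coe_pos.1 (div_pos hj (by norm_num))
  intro τ x R _ hτ _ _ hL h hc hh _ h0 x₀ hx₀ r hr hrR
  have hτ' : (τ : ℝ) < (1 - (Real.exp μ)⁻¹) / 10 := NNReal.coe_lt_coe.2 hτ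
  have key := Nh_le_of_lipGraph hΩ hc hh hL h0 hx₀ hr hrR hμ (by linarith) (by linarith)
  rw [hμε, mul_comm (1 + ε), mul_assoc] at key
  exact le_of_mul_le_mul_left key hμ2
end
end

section
/- Let ε > 0 and let τ_ε be as in the almost-monotonicity lemma for the doubling index. Suppose ∂Ω ∩ B ∈ Lip(τ) with τ < τ_ε, where B = B(x,R) is centered at x ∈ ∂Ω. Let x₁, x₂ ∈ closure(Ω) ∩ B(x, R/4) with |x₁ - x₂| < r/4 and 0 < r < R/8. If h is continuous on the closure of Ω, harmonic and nonzero in Ω, and h = 0 on ∂Ω ∩ B, then N_h(x₁, r/2) ≤ 3 (1+ε)² N_h(x₂, r). -/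
open Metric MeasureTheory Set
open scoped ENNReal NNReal

noncomputable section

section DoublingIndex

variable {d : ℕ} {Ω : Set (EuclideanSpace ℝ (Fin d))} {h : EuclideanSpace ℝ (Fin d) → ℝ}

/-- A function continuous on the closure of `Ω` is square integrable on bounded parts of `Ω`. -/
lemma integrableOn_sq_ball_inter (hcont : ContinuousOn h (closure Ω))
    (y : EuclideanSpace ℝ (Fin d)) (r : ℝ) :
    IntegrableOn (fun z => h z ^ 2) (ball y r ∩ Ω) := by
  have hK : IsCompact (closedBall y r ∩ closure Ω) :=
    (isCompact_closedBall y r).inter_right isClosed_closure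
  exact (((hcont.mono inter_subset_right).pow 2).integrableOn_compact hK).mono_set
    (inter_subset_inter ball_subset_closedBall subset_closure)

lemma Hh_nonneg_s7 (y : EuclideanSpace ℝ (Fin d)) (r : ℝ) : 0 ≤ Hh Ω h y r :=
  integral_nonneg fun _ => sq_nonneg _

lemma Hh_mono_s7 (hcont : ContinuousOn h (closure Ω)) {y z : EuclideanSpace ℝ (Fin d)} {r s : ℝ}
    (hsub : ball y r ⊆ ball z s) : Hh Ω h y r ≤ Hh Ω h z s :=
  setIntegral_mono_set (integrableOn_sq_ball_inter hcont z s)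
    (Filter.Eventually.of_forall fun _ => sq_nonneg _)
    (inter_subset_inter_left Ω hsub).eventuallyLE

lemma continuousAt_Hh (hΩ : MeasurableSet Ω) (hcont : ContinuousOn h (closure Ω))
    (y : EuclideanSpace ℝ (Fin d)) {r : ℝ} (hr : r ≠ 0) : ContinuousAt (Hh Ω h y) r := by
  have hmeas (s : ℝ) : MeasurableSet (ball y s ∩ Ω) := measurableSet_ball.inter hΩ
  have heq : Hh Ω h y = fun s => ∫ z, (ball y s ∩ Ω).indicator (fun z => h z ^ 2) z := by
    funext s
    exact (integral_indicator (hmeas s)).symm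
  rw [heq]
  refine continuousAt_of_dominated
    (bound := (ball y (r + 1) ∩ Ω).indicator (fun z => h z ^ 2)) ?_ ?_ ?_ ?_
  · exact Filter.Eventually.of_forall fun s =>
      ((integrableOn_sq_ball_inter hcont y s).integrable_indicator (hmeas s)).aestronglyMeasurable
  · filter_upwards [eventually_lt_nhds (lt_add_one r)] with s hs
    refine Filter.Eventually.of_forall fun z => ?_
    rw [Real.norm_of_nonneg (indicator_nonneg (fun _ _ => sq_nonneg _) z)]
    exact indicator_le_indicator_of_subset
      (inter_subset_inter_left Ω (ball_subset_ball hs.le)) (fun _ => sq_nonneg _) z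
  · exact (integrableOn_sq_ball_inter hcont y (r + 1)).integrable_indicator (hmeas _)
  · have hsphere : ∀ᵐ z, z ∉ sphere y r :=
      measure_eq_zero_iff_ae_notMem.mp (Measure.addHaar_sphere_of_ne_zero volume y hr)
    filter_upwards [hsphere] with z hz
    rcases lt_or_gt_of_ne (show dist z y ≠ r from hz) with hlt | hgt
    · refine (continuousAt_const (y := Ω.indicator (fun z => h z ^ 2) z)).congr ?_
      filter_upwards [eventually_gt_nhds hlt] with s hs
      have hmem : z ∈ ball y s ∩ Ω ↔ z ∈ Ω := and_iff_right (mem_ball.mpr hs)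
      by_cases hzΩ : z ∈ Ω <;> simp only [indicator, hmem, hzΩ]
    · refine (continuousAt_const (y := (0 : ℝ))).congr ?_
      filter_upwards [eventually_lt_nhds hgt] with s hs
      simp [indicator, mem_ball, not_lt.mpr hs.le]

lemma Nh_nonneg_s7 (hcont : ContinuousOn h (closure Ω)) (y : EuclideanSpace ℝ (Fin d)) {r : ℝ}
    (hr : 0 ≤ r) : 0 ≤ Nh Ω h y r := by
  rcases (Hh_nonneg_s7 (Ω := Ω) (h := h) y r).eq_or_lt' with h0 | hpos
  · simp [Nh, h0]
  · refine Real.log_nonneg ((one_le_div hpos).mpr ?_)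
    exact Hh_mono_s7 hcont (ball_subset_ball (by linarith))

end DoublingIndex

/-- Unique continuation from a doubling inequality: if `log (H (2 t) / H t)` is controlled by
`log (H (4 t) / H (2 t))` for `t < s`, then `H` cannot start vanishing before `s`. -/
lemma eq_zero_of_log_doubling {H : ℝ → ℝ} {C δ s : ℝ} (hC : 0 ≤ C) (hδ : 0 < δ) (hδs : δ ≤ s)
    (hmono : Monotone H) (hcont : ∀ t, 0 < t → ContinuousAt H t)
    (hdoub : ∀ t, 0 < t → t < s →
      Real.log (H (2 * t) / H t) ≤ C * Real.log (H (2 * (2 * t)) / H (2 * t)))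
    (hzero : H δ = 0) : H s = 0 := by
  by_contra hne
  have hs : 0 < H s := lt_of_le_of_ne (hzero ▸ hmono hδs) (Ne.symm hne)
  have hcontOn : ContinuousOn H (Icc δ s) := fun t ht =>
    (hcont t (hδ.trans_le ht.1)).continuousWithinAt
  have hcomp : IsCompact (Icc δ s ∩ H ⁻¹' {0}) :=
    isCompact_Icc.of_isClosed_subset
      (hcontOn.preimage_isClosed_of_isClosed isClosed_Icc isClosed_singleton) inter_subset_left
  obtain ⟨ρ, ⟨⟨hδρ, hρs⟩, hHρ⟩, hmax⟩ :=
    hcomp.exists_isGreatest ⟨δ, ⟨le_rfl, hδs⟩, hzero⟩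
  have hHρ : H ρ = 0 := hHρ
  have hρ : 0 < ρ := hδ.trans_le hδρ
  have hρs : ρ < s := lt_of_le_of_ne hρs fun he => hne (he ▸ hHρ)
  have hpos {t : ℝ} (ht : ρ < t) : 0 < H t := by
    rcases le_total t s with hts | hts
    · refine lt_of_le_of_ne (hHρ ▸ hmono ht.le) fun h0 => ?_
      exact ht.not_ge (hmax ⟨⟨hδρ.trans ht.le, hts⟩, h0.symm⟩)
    · exact hs.trans_le (hmono hts)
  have h2ρ : 0 < H (2 * ρ) := hpos (by linarith)
  set K := C * Real.log (H (2 * (2 * s)) / H (2 * ρ))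
  have hbound : ∀ᶠ t in nhdsWithin ρ (Ioi ρ), H (2 * ρ) ≤ Real.exp K * H t := by
    filter_upwards [Ioo_mem_nhdsGT hρs] with t ht
    have ht0 : 0 < H t := hpos ht.1
    have h2t : 0 < H (2 * t) := hpos (by linarith [ht.1])
    have hK : Real.log (H (2 * t) / H t) ≤ K := by
      refine (hdoub t (hρ.trans ht.1) ht.2).trans (mul_le_mul_of_nonneg_left ?_ hC)
      refine Real.log_le_log (div_pos (hpos (by linarith [ht.1])) h2t) ?_
      exact div_le_div₀ (hpos (by linarith)).le (hmono (by linarith [ht.2])) h2ρ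
        (hmono (by linarith [ht.1]))
    rw [Real.log_le_iff_le_exp (div_pos h2t ht0), div_le_iff₀ ht0] at hK
    exact (hmono (by linarith [ht.1])).trans hK
  have hlim : Filter.Tendsto (fun t => Real.exp K * H t) (nhdsWithin ρ (Ioi ρ))
      (nhds (Real.exp K * H ρ)) :=
    ((hcont ρ hρ).tendsto.mono_left nhdsWithin_le_nhds).const_mul _
  have hle := ge_of_tendsto hlim hbound
  rw [hHρ, mul_zero] at hle
  exact hle.not_gt h2ρ

/-- (Corollary 3.3.) Let `ε > 0` and let `τ_ε > 0` be as in the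
almost-monotonicity lemma (i.e. any `τ_ε` for which the conclusion of that lemma holds).
Suppose `∂Ω ∩ B(x,R) ∈ Lip(τ)` with `τ < τ_ε`, `x₁, x₂ ∈ closure Ω ∩ B(x,R/4)`,
`|x₁ - x₂| < r/4`, and `0 < r < R/8`. If `h` is continuous on `closure Ω`, harmonic and
nonzero in `Ω`, and `h = 0` on `∂Ω ∩ B(x,R)`, then `N_h(x₁, r/2) ≤ 3(1+ε)² N_h(x₂, r)`. -/
theorem stmt_7 (m : ℕ) (ε : ℝ) (hε : 0 < ε) (τε : ℝ≥0) (hτε : 0 < τε)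
    (hmono : ∀ (Ω : Set (Euc m)), IsOpen Ω → IsConnected Ω →
      ∀ (τ : ℝ≥0) (x : Euc m) (R : ℝ), 0 < τ → τ < τε → x ∈ frontier Ω → 0 < R →
        LipGraph Ω τ x R →
        ∀ h : Euc m → ℝ, ContinuousOn h (closure Ω) → IsHarmonicOn h Ω →
          (∃ y ∈ Ω, h y ≠ 0) →
          (∀ y ∈ frontier Ω ∩ ball x R, h y = 0) →
          ∀ x₀ ∈ closure Ω ∩ ball x (R / 4), ∀ r : ℝ, 0 < r → r < R / 16 →
            Nh Ω h x₀ r ≤ (1 + ε) * Nh Ω h x₀ (2 * r))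
    (Ω : Set (Euc m)) (hΩ : IsOpen Ω) (hconn : IsConnected Ω)
    (τ : ℝ≥0) (x : Euc m) (R : ℝ) (hτ0 : 0 < τ) (hτ : τ < τε) (hx : x ∈ frontier Ω)
    (hR : 0 < R) (hLip : LipGraph Ω τ x R)
    (x₁ x₂ : Euc m) (hx₁ : x₁ ∈ closure Ω ∩ ball x (R / 4))
    (hx₂ : x₂ ∈ closure Ω ∩ ball x (R / 4))
    (r : ℝ) (hr : 0 < r) (hrR : r < R / 8) (hdist : dist x₁ x₂ < r / 4)
    (h : Euc m → ℝ) (hcont : ContinuousOn h (closure Ω)) (hharm : IsHarmonicOn h Ω)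
    (hnz : ∃ y ∈ Ω, h y ≠ 0) (hzero : ∀ y ∈ frontier Ω ∩ ball x R, h y = 0) :
    Nh Ω h x₁ (r / 2) ≤ 3 * (1 + ε) ^ 2 * Nh Ω h x₂ r := by
  have hN := hmono Ω hΩ hconn τ x R hτ0 hτ hx hR hLip h hcont hharm hnz hzero
  have hHmono (y : Euc m) : Monotone (Hh Ω h y) := fun _ _ hst =>
    Hh_mono_s7 hcont (ball_subset_ball hst)
  have hN₂ : 0 ≤ Nh Ω h x₂ r := Nh_nonneg_s7 hcont x₂ hr.le
  rcases (Hh_nonneg_s7 (Ω := Ω) (h := h) x₁ (r / 2)).eq_or_lt' with h0 | hpos₁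
  · simp only [Nh, h0, div_zero, Real.log_zero] at hN₂ ⊢
    positivity
  have hpos₂ : 0 < Hh Ω h x₂ (r / 4) := by
    refine lt_of_le_of_ne (Hh_nonneg_s7 _ _) fun h0 => hpos₁.ne' ?_
    have hδ : Hh Ω h x₁ (r / 4 - dist x₁ x₂) = 0 :=
      le_antisymm (h0 ▸ Hh_mono_s7 hcont (ball_subset_ball' (by linarith))) (Hh_nonneg_s7 _ _)
    exact eq_zero_of_log_doubling (C := 1 + ε) (by linarith) (sub_pos.mpr hdist)
      (by linarith [dist_nonneg (x := x₁) (y := x₂)]) (hHmono x₁)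
      (fun t ht => continuousAt_Hh hΩ.measurableSet hcont x₁ ht.ne')
      (fun t ht hts => hN x₁ hx₁ t ht (by linarith)) hδ
  have hpos {t : ℝ} (ht : r / 4 ≤ t) : 0 < Hh Ω h x₂ t := hpos₂.trans_le (hHmono x₂ ht)
  have hsplit : Nh Ω h x₁ (r / 2) ≤ Nh Ω h x₂ (r / 4) + Nh Ω h x₂ (r / 2) + Nh Ω h x₂ r := by
    have hlog (t : ℝ) (ht : r / 4 ≤ t) :
        Nh Ω h x₂ t = Real.log (Hh Ω h x₂ (2 * t)) - Real.log (Hh Ω h x₂ t) :=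
      Real.log_div (hpos (by linarith)).ne' (hpos ht).ne'
    have hbig : Hh Ω h x₁ (2 * (r / 2)) ≤ Hh Ω h x₂ (2 * r) :=
      Hh_mono_s7 hcont (ball_subset_ball' (by linarith))
    have hsmall : Hh Ω h x₂ (r / 4) ≤ Hh Ω h x₁ (r / 2) :=
      Hh_mono_s7 hcont (ball_subset_ball' (by rw [dist_comm]; linarith))
    have hbig₀ : 0 < Hh Ω h x₁ (2 * (r / 2)) := hpos₁.trans_le (hHmono x₁ (by linarith))
    rw [hlog _ le_rfl, hlog (r / 2) (by linarith), hlog r (by linarith), Nh,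
      Real.log_div hbig₀.ne' hpos₁.ne', show 2 * (r / 4) = r / 2 by ring,
      show 2 * (r / 2) = r by ring]
    rw [show 2 * (r / 2) = r by ring] at hbig hbig₀
    linarith [Real.log_le_log hbig₀ hbig, Real.log_le_log hpos₂ hsmall]
  have hquarter := hN x₂ hx₂ (r / 4) (by linarith) (by linarith)
  have hhalf := hN x₂ hx₂ (r / 2) (by linarith) (by linarith)
  rw [show 2 * (r / 4) = r / 2 by ring] at hquarter
  rw [show 2 * (r / 2) = r by ring] at hhalf
  have hquarter' := hquarter.trans (mul_le_mul_of_nonneg_left hhalf (by linarith : 0 ≤ 1 + ε))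
  have hε₁ : 0 ≤ ε * Nh Ω h x₂ r := by positivity
  have hε₂ : 0 ≤ ε ^ 2 * Nh Ω h x₂ r := by positivity
  linarith
end
end
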